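/- arXiv:2410.11724 — 5 statements merged into one kernel-verified Lean document; each statement's English description precedes it below -/
import Mathlib

section
/- Let d ≥ 1 and 0 < α < 1, and let f : ℝ^d → ℝ be locally square-integrable. Then the following two conditions are equivalent, and the optimal constants satisfy B² ≈ C up to multiplicative factors depending only on d and α: (i) there exists B < ∞ such that for every z ∈ ℝ^d and R > 0, ∫_{B_R(z)} ∫_{B_R(z)} |f(x) − f(y)|² / |x − y|^{d+2α} dy dx ≤ B² R^d; (ii) there exists C < ∞ such that for every z ∈ ℝ^d and R > 0, ∫_0^R ∫_{B_R(z)} ( ν₀^f(x,r) / r^{α−1} )² dx dr/r ≤ C R^d. -/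
open MeasureTheory Metric

/-- `ν₀^f(x,r)`: the best `L²`-approximation of `f` by constants on `B_r(x)`, normalized by `r`. -/
noncomputable def nu0 (d : ℕ) (f : EuclideanSpace ℝ (Fin d) → ℝ)
    (x : EuclideanSpace ℝ (Fin d)) (r : ℝ) : ℝ :=
  ⨅ c : ℝ, Real.sqrt (⨍ y in ball x r, ((f y - c) / r) ^ 2)

section SquareFunction

open Set

variable {d : ℕ}

/-- The double integral of `|f y - f y'|²` over `B_r(x) × B_r(x)`. -/
noncomputable def ballOscillation (f : EuclideanSpace ℝ (Fin d) → ℝ)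
    (x : EuclideanSpace ℝ (Fin d)) (r : ℝ) : ENNReal :=
  ∫⁻ p in ball x r ×ˢ ball x r, ENNReal.ofReal ((f p.1 - f p.2) ^ 2)
    ∂(volume.prod volume)

/-- The volume of the unit ball as a real number. -/
noncomputable def unitBallVolume (d : ℕ) : ℝ :=
  (volume (ball (0 : EuclideanSpace ℝ (Fin d)) 1)).toReal

lemma unitBallVolume_pos : 0 < unitBallVolume d :=
  ENNReal.toReal_pos (measure_ball_pos _ _ one_pos).ne' measure_ball_lt_top.ne

lemma volume_ball_eq_ofReal (x : EuclideanSpace ℝ (Fin d)) {r : ℝ} (hr : 0 < r) :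
    volume (ball x r) = ENNReal.ofReal (unitBallVolume d * r ^ d) := by
  rw [Measure.addHaar_ball_of_pos _ _ hr, finrank_euclideanSpace_fin, unitBallVolume, mul_comm,
    ENNReal.ofReal_mul ENNReal.toReal_nonneg, ENNReal.ofReal_toReal measure_ball_lt_top.ne]

lemma integrableOn_ball_sub_const_sq {f : EuclideanSpace ℝ (Fin d) → ℝ} (hf : Measurable f)
    (hf2 : LocallyIntegrable (fun x => (f x) ^ 2) volume)
    (x : EuclideanSpace ℝ (Fin d)) (r c : ℝ) :
    IntegrableOn (fun y => (f y - c) ^ 2) (ball x r) := by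
  have h1 : IntegrableOn (fun x => (f x) ^ 2) (ball x r) :=
    (hf2.integrableOn_isCompact (isCompact_closedBall x r)).mono_set ball_subset_closedBall
  have : IsFiniteMeasure (volume.restrict (ball x r)) := ⟨by simp [measure_ball_lt_top]⟩
  have h2 : MemLp f 2 (volume.restrict (ball x r)) :=
    (memLp_two_iff_integrable_sq hf.aestronglyMeasurable).2 h1
  exact (h2.sub (memLp_const c)).integrable_sq

/-- The mean of `((f - c) / r)²` over a ball in terms of a lower integral. -/
lemma ofReal_average_eq {f : EuclideanSpace ℝ (Fin d) → ℝ} (hf : Measurable f)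
    (hf2 : LocallyIntegrable (fun x => (f x) ^ 2) volume)
    (x : EuclideanSpace ℝ (Fin d)) {r : ℝ} (hr : 0 < r) (c : ℝ) :
    ENNReal.ofReal (unitBallVolume d * r ^ d * r ^ 2 * ⨍ y in ball x r, ((f y - c) / r) ^ 2) =
      ∫⁻ y in ball x r, ENNReal.ofReal ((f y - c) ^ 2) := by
  rw [← ofReal_integral_eq_lintegral_ofReal (integrableOn_ball_sub_const_sq hf hf2 x r c)
    (Filter.Eventually.of_forall fun _ => sq_nonneg _)]
  congr 1
  have hv : 0 < unitBallVolume d * r ^ d := mul_pos unitBallVolume_pos (pow_pos hr d)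
  rw [setAverage_eq]
  simp_rw [div_pow]
  rw [integral_div, measureReal_def, volume_ball_eq_ofReal x hr, ENNReal.toReal_ofReal hv.le,
    smul_eq_mul]
  have := (unitBallVolume_pos (d := d)).ne'
  field_simp

lemma nu0_nonneg (f : EuclideanSpace ℝ (Fin d) → ℝ) (x : EuclideanSpace ℝ (Fin d)) (r : ℝ) :
    0 ≤ nu0 d f x r :=
  Real.iInf_nonneg fun _ => Real.sqrt_nonneg _

lemma average_sq_nonneg (f : EuclideanSpace ℝ (Fin d) → ℝ) (x : EuclideanSpace ℝ (Fin d))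
    (r c : ℝ) : 0 ≤ ⨍ y in ball x r, ((f y - c) / r) ^ 2 := by
  rw [setAverage_eq]
  exact smul_nonneg (by positivity) (integral_nonneg fun _ => sq_nonneg _)

lemma nu0_sq_le (f : EuclideanSpace ℝ (Fin d) → ℝ) (x : EuclideanSpace ℝ (Fin d)) (r c : ℝ) :
    nu0 d f x r ^ 2 ≤ ⨍ y in ball x r, ((f y - c) / r) ^ 2 := by
  rw [← Real.sq_sqrt (average_sq_nonneg f x r c)]
  refine pow_le_pow_left₀ (nu0_nonneg f x r) (ciInf_le ⟨0, ?_⟩ c) 2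
  rintro _ ⟨c, rfl⟩
  exact Real.sqrt_nonneg _

lemma measurable_ofReal_sub_sq {f : EuclideanSpace ℝ (Fin d) → ℝ} (hf : Measurable f) :
    Measurable fun p : EuclideanSpace ℝ (Fin d) × EuclideanSpace ℝ (Fin d) =>
      ENNReal.ofReal ((f p.1 - f p.2) ^ 2) := by
  fun_prop

lemma setLIntegral_prod_eq {g : EuclideanSpace ℝ (Fin d) × EuclideanSpace ℝ (Fin d) → ENNReal}
    (hg : Measurable g) (s t : Set (EuclideanSpace ℝ (Fin d))) :
    ∫⁻ p in s ×ˢ t, g p ∂(volume.prod volume) = ∫⁻ x in s, ∫⁻ y in t, g (x, y) := by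
  rw [← Measure.prod_restrict, lintegral_prod _ hg.aemeasurable]

lemma ofReal_nu0_sq_le_ballOscillation {f : EuclideanSpace ℝ (Fin d) → ℝ} (hf : Measurable f)
    (hf2 : LocallyIntegrable (fun x => (f x) ^ 2) volume)
    (x : EuclideanSpace ℝ (Fin d)) {r : ℝ} (hr : 0 < r) :
    ENNReal.ofReal ((unitBallVolume d * r ^ d) ^ 2 * r ^ 2 * nu0 d f x r ^ 2) ≤
      ballOscillation f x r := by
  have hv : 0 < unitBallVolume d * r ^ d := mul_pos unitBallVolume_pos (pow_pos hr d)
  rw [ballOscillation, setLIntegral_prod_eq (measurable_ofReal_sub_sq hf)]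
  calc ENNReal.ofReal ((unitBallVolume d * r ^ d) ^ 2 * r ^ 2 * nu0 d f x r ^ 2)
      = ∫⁻ _ in ball x r, ENNReal.ofReal (unitBallVolume d * r ^ d * r ^ 2 * nu0 d f x r ^ 2) := by
        rw [setLIntegral_const, volume_ball_eq_ofReal x hr, ← ENNReal.ofReal_mul (by positivity)]
        ring_nf
    _ ≤ ∫⁻ y' in ball x r, ∫⁻ y in ball x r, ENNReal.ofReal ((f y' - f y) ^ 2) := by
        refine lintegral_mono fun y' => ?_
        simp_rw [← neg_sub (f _) (f y'), neg_sq]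
        rw [← ofReal_average_eq hf hf2 x hr]
        gcongr
        exact nu0_sq_le f x r (f y')

lemma ballOscillation_le_ofReal_nu0_sq {f : EuclideanSpace ℝ (Fin d) → ℝ} (hf : Measurable f)
    (hf2 : LocallyIntegrable (fun x => (f x) ^ 2) volume)
    (x : EuclideanSpace ℝ (Fin d)) {r : ℝ} (hr : 0 < r) :
    ballOscillation f x r ≤
      ENNReal.ofReal (4 * (unitBallVolume d * r ^ d) ^ 2 * r ^ 2 * nu0 d f x r ^ 2) := by
  have hv : 0 < unitBallVolume d * r ^ d := mul_pos unitBallVolume_pos (pow_pos hr d)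
  set v := unitBallVolume d * r ^ d with hvdef
  have key : ∀ c : ℝ, ballOscillation f x r ≤
      ENNReal.ofReal (4 * v ^ 2 * r ^ 2 * ⨍ y in ball x r, ((f y - c) / r) ^ 2) := by
    intro c
    have hA := average_sq_nonneg f x r c
    have hc := ofReal_average_eq hf hf2 x hr c
    set A := ⨍ y in ball x r, ((f y - c) / r) ^ 2
    have hm : Measurable fun y => ENNReal.ofReal (2 * (f y - c) ^ 2) := by fun_prop
    have h2 : ∫⁻ y in ball x r, ENNReal.ofReal (2 * (f y - c) ^ 2) =
        ENNReal.ofReal (2 * (v * r ^ 2 * A)) := by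
      simp_rw [ENNReal.ofReal_mul (zero_le_two (α := ℝ))]
      rw [lintegral_const_mul _ (by fun_prop), ← hc]
    rw [ballOscillation, setLIntegral_prod_eq (measurable_ofReal_sub_sq hf)]
    calc ∫⁻ y in ball x r, ∫⁻ y' in ball x r, ENNReal.ofReal ((f y - f y') ^ 2)
        ≤ ∫⁻ y in ball x r, ∫⁻ y' in ball x r,
            (ENNReal.ofReal (2 * (f y - c) ^ 2) + ENNReal.ofReal (2 * (f y' - c) ^ 2)) := by
          refine lintegral_mono fun y => lintegral_mono fun y' => ?_
          rw [← ENNReal.ofReal_add (by positivity) (by positivity)]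
          refine ENNReal.ofReal_le_ofReal ?_
          nlinarith [sq_nonneg (f y - c + (f y' - c))]
      _ = ENNReal.ofReal (4 * v ^ 2 * r ^ 2 * A) := by
          simp_rw [lintegral_add_right _ hm, h2, setLIntegral_const]
          rw [lintegral_add_right _ (by fun_prop), lintegral_mul_const _ hm, h2,
            setLIntegral_const, volume_ball_eq_ofReal x hr, ← hvdef,
            ← ENNReal.ofReal_mul (by positivity), ← ENNReal.ofReal_add (by positivity)
            (by positivity)]
          ring_nf
  have hfin : ballOscillation f x r ≠ ⊤ := ((key 0).trans_lt ENNReal.ofReal_lt_top).ne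
  set e := (ballOscillation f x r).toReal
  have he : 0 ≤ e := ENNReal.toReal_nonneg
  have hle : √(e / (4 * v ^ 2 * r ^ 2)) ≤ nu0 d f x r := by
    refine le_ciInf fun c => Real.sqrt_le_sqrt ?_
    rw [div_le_iff₀' (by positivity)]
    exact ENNReal.toReal_le_of_le_ofReal
      (mul_nonneg (by positivity) (average_sq_nonneg f x r c)) (key c)
  have hsq : e / (4 * v ^ 2 * r ^ 2) ≤ nu0 d f x r ^ 2 := (Real.sqrt_le_left (nu0_nonneg f x r)).1 hle
  rw [← ENNReal.ofReal_toReal hfin]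
  exact ENNReal.ofReal_le_ofReal ((div_le_iff₀' (by positivity)).1 hsq)

lemma ofReal_square_function_density (f : EuclideanSpace ℝ (Fin d) → ℝ) (α : ℝ)
    (x : EuclideanSpace ℝ (Fin d)) {r : ℝ} (hr : 0 < r) :
    ENNReal.ofReal ((nu0 d f x r / r ^ (α - 1)) ^ 2) / ENNReal.ofReal r =
      ENNReal.ofReal (r ^ (-(2 * α + 1 + 2 * d)) * (r ^ d * r * nu0 d f x r) ^ 2) := by
  rw [← ENNReal.ofReal_div_of_pos hr]
  congr 1
  have h1 : r ^ (-(2 * α + 1 + 2 * d)) * (r ^ d * r) ^ 2 * (r ^ (α - 1)) ^ 2 * r = 1 := by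
    rw [← Real.rpow_natCast r d, ← Real.rpow_add_one hr.ne', ← Real.rpow_natCast _ 2,
      ← Real.rpow_natCast _ 2, ← Real.rpow_mul hr.le, ← Real.rpow_mul hr.le,
      ← Real.rpow_add hr, ← Real.rpow_add hr, ← Real.rpow_add_one hr.ne']
    convert Real.rpow_zero r using 2
    push_cast
    ring
  have h2 : r ^ (α - 1) ≠ 0 := (Real.rpow_pos_of_pos hr _).ne'
  rw [div_pow, div_div, div_eq_iff (by positivity)]
  linear_combination -(nu0 d f x r) ^ 2 * h1

/-- The kernel produced by integrating out the centres and radii of the balls containing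
both points. -/
noncomputable def ballKernel (α : ℝ) (z : EuclideanSpace ℝ (Fin d)) (T : ℝ)
    (p : EuclideanSpace ℝ (Fin d) × EuclideanSpace ℝ (Fin d)) : ENNReal :=
  ∫⁻ r in Ioo 0 T, ENNReal.ofReal (r ^ (-(2 * α + 1 + 2 * d))) *
    volume (ball p.1 r ∩ ball p.2 r ∩ ball z T)

lemma lintegral_ballOscillation_eq {f : EuclideanSpace ℝ (Fin d) → ℝ} (hf : Measurable f)
    (α : ℝ) (z : EuclideanSpace ℝ (Fin d)) (T : ℝ) :
    ∫⁻ r in Ioo 0 T, ∫⁻ x in ball z T,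
      ENNReal.ofReal (r ^ (-(2 * α + 1 + 2 * d))) * ballOscillation f x r =
    ∫⁻ p, ENNReal.ofReal ((f p.1 - f p.2) ^ 2) * ballKernel α z T p ∂(volume.prod volume) := by
  let S : Set ((ℝ × EuclideanSpace ℝ (Fin d)) ×
      (EuclideanSpace ℝ (Fin d) × EuclideanSpace ℝ (Fin d))) :=
    {q | q.1.2 ∈ ball q.2.1 q.1.1 ∩ ball q.2.2 q.1.1}
  have hS : MeasurableSet S := by
    refine (measurableSet_lt ?_ ?_).inter (measurableSet_lt ?_ ?_) <;> fun_prop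
  let G : (ℝ × EuclideanSpace ℝ (Fin d)) ×
      (EuclideanSpace ℝ (Fin d) × EuclideanSpace ℝ (Fin d)) → ENNReal := fun q =>
    ENNReal.ofReal ((f q.2.1 - f q.2.2) ^ 2) *
      (ENNReal.ofReal (q.1.1 ^ (-(2 * α + 1 + 2 * d))) * S.indicator 1 q)
  have hG : Measurable G :=
    (by fun_prop : Measurable fun q : (ℝ × EuclideanSpace ℝ (Fin d)) ×
      (EuclideanSpace ℝ (Fin d) × EuclideanSpace ℝ (Fin d)) =>
        ENNReal.ofReal ((f q.2.1 - f q.2.2) ^ 2)).mul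
      ((by fun_prop : Measurable fun q : (ℝ × EuclideanSpace ℝ (Fin d)) ×
      (EuclideanSpace ℝ (Fin d) × EuclideanSpace ℝ (Fin d)) =>
        ENNReal.ofReal (q.1.1 ^ (-(2 * α + 1 + 2 * d)))).mul (measurable_one.indicator hS))
  let μ := (volume.restrict (Ioo 0 T)).prod
    (volume.restrict (ball z T) : Measure (EuclideanSpace ℝ (Fin d)))
  have hleft : ∀ r x, ENNReal.ofReal (r ^ (-(2 * α + 1 + 2 * d))) * ballOscillation f x r =
      ∫⁻ p, G ((r, x), p) ∂(volume.prod volume) := by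
    intro r x
    rw [ballOscillation, ← lintegral_indicator (measurableSet_ball.prod measurableSet_ball),
      ← lintegral_const_mul _ ((measurable_ofReal_sub_sq hf).indicator
        (measurableSet_ball.prod measurableSet_ball))]
    refine lintegral_congr fun p => ?_
    by_cases hp : p ∈ ball x r ×ˢ ball x r
    · have : ((r, x), p) ∈ S := ⟨mem_ball_comm.1 hp.1, mem_ball_comm.1 hp.2⟩
      simp [G, indicator_of_mem hp, indicator_of_mem this, mul_comm]
    · have : ((r, x), p) ∉ S := fun h => hp ⟨mem_ball_comm.1 h.1, mem_ball_comm.1 h.2⟩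
      simp [G, indicator_of_notMem hp, indicator_of_notMem this]
  have hright : ∀ p, ENNReal.ofReal ((f p.1 - f p.2) ^ 2) * ballKernel α z T p =
      ∫⁻ q, G (q, p) ∂μ := by
    intro p
    have hm : MeasurableSet {q | (q, p) ∈ S} := measurable_prodMk_right hS
    simp only [G, μ]
    rw [lintegral_const_mul, lintegral_prod, ballKernel]
    · congr 1
      refine lintegral_congr fun r => ?_
      have hb : MeasurableSet (ball p.1 r ∩ ball p.2 r) :=
        measurableSet_ball.inter measurableSet_ball
      dsimp only
      rw [lintegral_const_mul' _ _ ENNReal.ofReal_ne_top, ← Measure.restrict_apply hb,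
        ← lintegral_indicator_one hb]
      rfl
    · exact (Measurable.mul (by fun_prop) (measurable_one.indicator hm)).aemeasurable
    · exact Measurable.mul (by fun_prop) (measurable_one.indicator hm)
  simp_rw [hright, hleft]
  rw [lintegral_lintegral_swap (f := fun p q => G (q, p)) (hG.comp measurable_swap).aemeasurable]
  exact (lintegral_prod (μ := volume.restrict (Ioo 0 T)) (ν := volume.restrict (ball z T))
    (fun q => ∫⁻ p, G (q, p) ∂(volume.prod volume)) hG.lintegral_prod_right'.aemeasurable).symm

lemma ballKernel_eq_zero {α : ℝ} {z : EuclideanSpace ℝ (Fin d)} {T : ℝ}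
    {p : EuclideanSpace ℝ (Fin d) × EuclideanSpace ℝ (Fin d)}
    (hp : p ∉ ball z (2 * T) ×ˢ ball z (2 * T)) : ballKernel α z T p = 0 := by
  rw [ballKernel, ← lintegral_zero]
  refine setLIntegral_congr_fun measurableSet_Ioo fun r hr => ?_
  have : ball p.1 r ∩ ball p.2 r ∩ ball z T = ∅ := by
    refine eq_empty_of_forall_notMem fun x hx => hp ?_
    obtain ⟨⟨h1, h2⟩, h3⟩ := hx
    rw [mem_ball'] at h1 h2
    rw [mem_ball] at h3
    constructor <;> rw [mem_ball]
    · linarith [dist_triangle p.1 x z, hr.2]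
    · linarith [dist_triangle p.2 x z, hr.2]
  simp [this]

lemma ballKernel_le {α : ℝ} (hα : 0 < α) (z : EuclideanSpace ℝ (Fin d)) (T : ℝ)
    {p : EuclideanSpace ℝ (Fin d) × EuclideanSpace ℝ (Fin d)} (hp : p.1 ≠ p.2) :
    ballKernel α z T p ≤ ENNReal.ofReal (unitBallVolume d * 2 ^ ((d : ℝ) + 2 * α) /
      (d + 2 * α) / ‖p.1 - p.2‖ ^ ((d : ℝ) + 2 * α)) := by
  set ρ := ‖p.1 - p.2‖ with hρ
  have hρ0 : 0 < ρ := norm_pos_iff.2 (sub_ne_zero.2 hp)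
  have hs : 0 < (d : ℝ) + 2 * α := by positivity
  have hlt : -((d : ℝ) + 2 * α) - 1 < -1 := by linarith
  calc ballKernel α z T p
      ≤ ∫⁻ r in Ioo 0 T, (Ioi (ρ / 2)).indicator (fun r =>
          ENNReal.ofReal (unitBallVolume d * r ^ (-((d : ℝ) + 2 * α) - 1))) r := by
        refine setLIntegral_mono' measurableSet_Ioo fun r hr => ?_
        by_cases hr2 : r ∈ Ioi (ρ / 2)
        · rw [indicator_of_mem hr2]
          calc _ ≤ ENNReal.ofReal (r ^ (-(2 * α + 1 + 2 * d))) * volume (ball p.1 r) := by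
                gcongr
                exact inter_subset_left.trans inter_subset_left
            _ = _ := by
                rw [volume_ball_eq_ofReal _ hr.1,
                  ← ENNReal.ofReal_mul (Real.rpow_nonneg hr.1.le _), mul_left_comm,
                  ← Real.rpow_natCast r d, ← Real.rpow_add hr.1]
                congr 3
                ring
        · have : ball p.1 r ∩ ball p.2 r ∩ ball z T = ∅ := by
            refine eq_empty_of_forall_notMem fun x hx => hr2 ?_
            obtain ⟨⟨h1, h2⟩, -⟩ := hx
            rw [mem_ball'] at h1
            rw [mem_ball] at h2
            rw [mem_Ioi, hρ, ← dist_eq_norm]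
            linarith [dist_triangle p.1 x p.2]
          simp [this]
    _ ≤ ∫⁻ r in Ioi (ρ / 2),
          ENNReal.ofReal (unitBallVolume d * r ^ (-((d : ℝ) + 2 * α) - 1)) := by
        rw [← lintegral_indicator measurableSet_Ioi]
        exact setLIntegral_le_lintegral _ _
    _ = _ := by
        rw [← ofReal_integral_eq_lintegral_ofReal
          ((integrableOn_Ioi_rpow_of_lt hlt (by positivity)).const_mul _),
          integral_const_mul, integral_Ioi_rpow_of_lt hlt (by positivity)]
        · congr 1
          rw [sub_add_cancel, Real.rpow_neg (by positivity), Real.div_rpow hρ0.le zero_le_two]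
          have := Real.rpow_pos_of_pos hρ0 ((d : ℝ) + 2 * α)
          field_simp
        · filter_upwards [ae_restrict_mem measurableSet_Ioi] with r hr
          have : 0 < r := lt_trans (by positivity) hr
          exact mul_nonneg unitBallVolume_pos.le (Real.rpow_nonneg this.le _)

lemma le_ballKernel {α : ℝ} (hα : 0 < α) (z : EuclideanSpace ℝ (Fin d)) {R : ℝ}
    {p : EuclideanSpace ℝ (Fin d) × EuclideanSpace ℝ (Fin d)}
    (hz : p ∈ ball z R ×ˢ ball z R) (hp : p.1 ≠ p.2) :
    ENNReal.ofReal (unitBallVolume d * 2 ^ (-(2 * α + 1 + 3 * d)) /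
      ‖p.1 - p.2‖ ^ ((d : ℝ) + 2 * α)) ≤ ballKernel α z (4 * R) p := by
  set ρ := ‖p.1 - p.2‖ with hρ
  have hρ0 : 0 < ρ := norm_pos_iff.2 (sub_ne_zero.2 hp)
  have h1 : dist p.1 z < R := hz.1
  have h2 : dist p.2 z < R := hz.2
  have hρd : dist p.1 p.2 = ρ := dist_eq_norm _ _
  have hρR : ρ < 2 * R := by linarith [dist_triangle_right p.1 p.2 z]
  calc _ = ∫⁻ _ in Ioo ρ (2 * ρ), ENNReal.ofReal ((2 * ρ) ^ (-(2 * α + 1 + 2 * d)) *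
            (unitBallVolume d * (ρ / 2) ^ d)) := by
        rw [setLIntegral_const, Real.volume_Ioo, ← ENNReal.ofReal_mul
          (mul_nonneg (by positivity) (mul_nonneg unitBallVolume_pos.le (by positivity)))]
        congr 1
        have e1 : (2 * ρ) ^ (-(2 * α + 1 + 2 * d)) =
            2 ^ (-(2 * α + 1 + 3 * d)) * 2 ^ d * (ρ ^ ((d : ℝ) + 2 * α) * ρ * ρ ^ d)⁻¹ := by
          rw [Real.mul_rpow zero_le_two hρ0.le, ← Real.rpow_natCast, ← Real.rpow_natCast,
            ← Real.rpow_add zero_lt_two, ← Real.rpow_add_one hρ0.ne', ← Real.rpow_add hρ0,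
            ← Real.rpow_neg hρ0.le]
          congr 2 <;> ring
        have := Real.rpow_pos_of_pos hρ0 ((d : ℝ) + 2 * α)
        rw [e1, div_pow]
        field_simp
        ring
    _ ≤ ∫⁻ r in Ioo ρ (2 * ρ), ENNReal.ofReal (r ^ (-(2 * α + 1 + 2 * d))) *
          volume (ball p.1 r ∩ ball p.2 r ∩ ball z (4 * R)) := by
        refine setLIntegral_mono' measurableSet_Ioo fun r hr => ?_
        have hr0 : 0 < r := hρ0.trans hr.1
        rw [ENNReal.ofReal_mul (by positivity), ← volume_ball_eq_ofReal
          (midpoint ℝ p.1 p.2) (by positivity)]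
        refine mul_le_mul' (ENNReal.ofReal_le_ofReal
          (Real.rpow_le_rpow_of_nonpos hr0 hr.2.le ?_)) (measure_mono fun x hx => ?_)
        · have : 0 < 2 * α + 1 + 2 * d := by positivity
          linarith
        · rw [mem_ball] at hx
          have m1 : dist (midpoint ℝ p.1 p.2) p.1 = ρ / 2 := by
            rw [dist_midpoint_left, hρd, Real.norm_ofNat]; ring
          have m2 : dist (midpoint ℝ p.1 p.2) p.2 = ρ / 2 := by
            rw [dist_midpoint_right, hρd, Real.norm_ofNat]; ring
          have t1 := dist_triangle x (midpoint ℝ p.1 p.2) p.1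
          have t2 := dist_triangle x (midpoint ℝ p.1 p.2) p.2
          have t3 := dist_triangle x p.1 z
          refine ⟨⟨?_, ?_⟩, ?_⟩ <;> rw [mem_ball] <;> linarith [hr.1]
    _ ≤ ballKernel α z (4 * R) p :=
        lintegral_mono_set fun r hr => ⟨hρ0.trans hr.1, by linarith [hr.2]⟩

lemma lintegral_strichartz_eq {f : EuclideanSpace ℝ (Fin d) → ℝ} (hf : Measurable f)
    (s : ℝ) (z : EuclideanSpace ℝ (Fin d)) (R : ℝ) :
    ∫⁻ x in ball z R, ∫⁻ y in ball z R,
        ENNReal.ofReal (|f x - f y| ^ 2 / ‖x - y‖ ^ s) =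
      ∫⁻ p in ball z R ×ˢ ball z R, ENNReal.ofReal ((f p.1 - f p.2) ^ 2 / ‖p.1 - p.2‖ ^ s)
        ∂(volume.prod volume) := by
  rw [setLIntegral_prod_eq (by fun_prop)]
  simp_rw [sq_abs]

/-- The square function is controlled by the Strichartz double integral on the doubled ball. -/
lemma square_function_le_strichartz {f : EuclideanSpace ℝ (Fin d) → ℝ} (hf : Measurable f)
    (hf2 : LocallyIntegrable (fun x => (f x) ^ 2) volume) {α : ℝ} (hα : 0 < α)
    (z : EuclideanSpace ℝ (Fin d)) (R : ℝ) :
    ∫⁻ r in Ioo (0 : ℝ) R, (∫⁻ x in ball z R,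
        ENNReal.ofReal ((nu0 d f x r / r ^ (α - 1)) ^ 2)) / ENNReal.ofReal r ≤
      ENNReal.ofReal (2 ^ ((d : ℝ) + 2 * α) / ((d + 2 * α) * unitBallVolume d)) *
        ∫⁻ x in ball z (2 * R), ∫⁻ y in ball z (2 * R),
          ENNReal.ofReal (|f x - f y| ^ 2 / ‖x - y‖ ^ ((d : ℝ) + 2 * α)) := by
  have hv := unitBallVolume_pos (d := d)
  have hpt : ∀ r ∈ Ioo (0 : ℝ) R, (∫⁻ x in ball z R,
      ENNReal.ofReal ((nu0 d f x r / r ^ (α - 1)) ^ 2)) / ENNReal.ofReal r ≤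
      ENNReal.ofReal ((unitBallVolume d ^ 2)⁻¹) * ∫⁻ x in ball z R,
        ENNReal.ofReal (r ^ (-(2 * α + 1 + 2 * d))) * ballOscillation f x r := by
    intro r hr
    have hr' : (ENNReal.ofReal r)⁻¹ ≠ ⊤ := by simpa using hr.1
    rw [div_eq_mul_inv, ← lintegral_mul_const' _ _ hr',
      ← lintegral_const_mul' _ _ ENNReal.ofReal_ne_top]
    refine lintegral_mono fun x => ?_
    dsimp only
    rw [← div_eq_mul_inv, ofReal_square_function_density f α x hr.1]
    have hw : 0 ≤ r ^ (-(2 * α + 1 + 2 * d)) := Real.rpow_nonneg hr.1.le _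
    calc _ = ENNReal.ofReal ((unitBallVolume d ^ 2)⁻¹) *
          (ENNReal.ofReal (r ^ (-(2 * α + 1 + 2 * d))) *
          ENNReal.ofReal ((unitBallVolume d * r ^ d) ^ 2 * r ^ 2 * nu0 d f x r ^ 2)) := by
          rw [← ENNReal.ofReal_mul hw, ← ENNReal.ofReal_mul (by positivity)]
          congr 1
          field_simp
      _ ≤ _ := by
          gcongr
          exact ofReal_nu0_sq_le_ballOscillation hf hf2 x hr.1
  calc _ ≤ ∫⁻ r in Ioo 0 R, ENNReal.ofReal ((unitBallVolume d ^ 2)⁻¹) * ∫⁻ x in ball z R,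
          ENNReal.ofReal (r ^ (-(2 * α + 1 + 2 * d))) * ballOscillation f x r :=
        setLIntegral_mono' measurableSet_Ioo hpt
    _ = ENNReal.ofReal ((unitBallVolume d ^ 2)⁻¹) * ∫⁻ p,
          ENNReal.ofReal ((f p.1 - f p.2) ^ 2) * ballKernel α z R p ∂(volume.prod volume) := by
        rw [lintegral_const_mul' _ _ ENNReal.ofReal_ne_top, lintegral_ballOscillation_eq hf]
    _ ≤ ENNReal.ofReal ((unitBallVolume d ^ 2)⁻¹) * ∫⁻ p in ball z (2 * R) ×ˢ ball z (2 * R),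
          ENNReal.ofReal (unitBallVolume d * 2 ^ ((d : ℝ) + 2 * α) / (d + 2 * α)) *
            ENNReal.ofReal ((f p.1 - f p.2) ^ 2 / ‖p.1 - p.2‖ ^ ((d : ℝ) + 2 * α))
          ∂(volume.prod volume) := by
        refine mul_le_mul_right ?_ _
        rw [← lintegral_indicator (measurableSet_ball.prod measurableSet_ball)]
        refine lintegral_mono fun p => ?_
        by_cases hp : p ∈ ball z (2 * R) ×ˢ ball z (2 * R)
        · rw [indicator_of_mem hp]
          by_cases hne : p.1 = p.2
          · simp [hne]
          · calc _ ≤ _ := mul_le_mul_right (ballKernel_le hα z R hne) _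
              _ = _ := by
                rw [← ENNReal.ofReal_mul (by positivity), ← ENNReal.ofReal_mul (by positivity)]
                ring_nf
        · simp [ballKernel_eq_zero hp]
    _ = _ := by
        rw [lintegral_const_mul' _ _ ENNReal.ofReal_ne_top, ← mul_assoc,
          ← ENNReal.ofReal_mul (by positivity), lintegral_strichartz_eq hf]
        congr 2
        field_simp

/-- The Strichartz double integral is controlled by the square function on a dilated ball. -/
lemma strichartz_le_square_function {f : EuclideanSpace ℝ (Fin d) → ℝ} (hf : Measurable f)
    (hf2 : LocallyIntegrable (fun x => (f x) ^ 2) volume) {α : ℝ} (hα : 0 < α)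
    (z : EuclideanSpace ℝ (Fin d)) (R : ℝ) :
    ∫⁻ x in ball z R, ∫⁻ y in ball z R,
        ENNReal.ofReal (|f x - f y| ^ 2 / ‖x - y‖ ^ ((d : ℝ) + 2 * α)) ≤
      ENNReal.ofReal (4 * unitBallVolume d * 2 ^ (2 * α + 1 + 3 * d)) *
        ∫⁻ r in Ioo (0 : ℝ) (4 * R), (∫⁻ x in ball z (4 * R),
          ENNReal.ofReal ((nu0 d f x r / r ^ (α - 1)) ^ 2)) / ENNReal.ofReal r := by
  have hv := unitBallVolume_pos (d := d)
  have hpt : ∀ r ∈ Ioo (0 : ℝ) (4 * R), ∫⁻ x in ball z (4 * R),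
        ENNReal.ofReal (r ^ (-(2 * α + 1 + 2 * d))) * ballOscillation f x r ≤
      ENNReal.ofReal (4 * unitBallVolume d ^ 2) * ((∫⁻ x in ball z (4 * R),
        ENNReal.ofReal ((nu0 d f x r / r ^ (α - 1)) ^ 2)) / ENNReal.ofReal r) := by
    intro r hr
    have hr' : (ENNReal.ofReal r)⁻¹ ≠ ⊤ := by simpa using hr.1
    rw [div_eq_mul_inv, ← lintegral_mul_const' _ _ hr',
      ← lintegral_const_mul' _ _ ENNReal.ofReal_ne_top]
    refine lintegral_mono fun x => ?_
    dsimp only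
    rw [← div_eq_mul_inv, ofReal_square_function_density f α x hr.1]
    have hw : 0 ≤ r ^ (-(2 * α + 1 + 2 * d)) := Real.rpow_nonneg hr.1.le _
    calc _ ≤ _ := mul_le_mul_right (ballOscillation_le_ofReal_nu0_sq hf hf2 x hr.1) _
      _ = _ := by
          rw [← ENNReal.ofReal_mul hw, ← ENNReal.ofReal_mul (by positivity)]
          ring_nf
  have hK : ENNReal.ofReal ((unitBallVolume d)⁻¹ * 2 ^ (2 * α + 1 + 3 * d)) *
      ENNReal.ofReal (4 * unitBallVolume d ^ 2) =
      ENNReal.ofReal (4 * unitBallVolume d * 2 ^ (2 * α + 1 + 3 * d)) := by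
    rw [← ENNReal.ofReal_mul (by positivity)]
    congr 1
    field_simp
  rw [lintegral_strichartz_eq hf]
  calc _ ≤ ∫⁻ p, ENNReal.ofReal ((unitBallVolume d)⁻¹ * 2 ^ (2 * α + 1 + 3 * d)) *
          (ENNReal.ofReal ((f p.1 - f p.2) ^ 2) * ballKernel α z (4 * R) p)
          ∂(volume.prod volume) := by
        rw [← lintegral_indicator (measurableSet_ball.prod measurableSet_ball)]
        refine lintegral_mono fun p => ?_
        by_cases hp : p ∈ ball z R ×ˢ ball z R
        · rw [indicator_of_mem hp]
          by_cases hne : p.1 = p.2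
          · simp [hne]
          · refine le_trans (le_of_eq ?_) (mul_le_mul_right (mul_le_mul_right
              (le_ballKernel hα z hp hne) _) _)
            rw [← ENNReal.ofReal_mul (by positivity), ← ENNReal.ofReal_mul (by positivity)]
            congr 1
            rw [Real.rpow_neg zero_le_two]
            field_simp
        · simp [indicator_of_notMem hp]
    _ = ENNReal.ofReal ((unitBallVolume d)⁻¹ * 2 ^ (2 * α + 1 + 3 * d)) *
          ∫⁻ r in Ioo 0 (4 * R), ∫⁻ x in ball z (4 * R),
            ENNReal.ofReal (r ^ (-(2 * α + 1 + 2 * d))) * ballOscillation f x r := by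
        rw [lintegral_const_mul' _ _ ENNReal.ofReal_ne_top, lintegral_ballOscillation_eq hf]
    _ ≤ ENNReal.ofReal ((unitBallVolume d)⁻¹ * 2 ^ (2 * α + 1 + 3 * d)) *
          ∫⁻ r in Ioo 0 (4 * R), ENNReal.ofReal (4 * unitBallVolume d ^ 2) *
            ((∫⁻ x in ball z (4 * R),
              ENNReal.ofReal ((nu0 d f x r / r ^ (α - 1)) ^ 2)) / ENNReal.ofReal r) :=
        mul_le_mul_right (setLIntegral_mono' measurableSet_Ioo hpt) _
    _ = _ := by
        rw [lintegral_const_mul' _ _ ENNReal.ofReal_ne_top, ← mul_assoc, hK]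

end SquareFunction

/-- For `0 < α < 1` and `f` locally square-integrable, the Strichartz
condition `∫_{B_R(z)}∫_{B_R(z)} |f(x)−f(y)|²/|x−y|^{d+2α} ≤ B² R^d` and the square function
condition `∫_0^R ∫_{B_R(z)} (ν₀^f(x,r)/r^{α−1})² dx dr/r ≤ C R^d` are equivalent, with optimal
constants satisfying `B² ≈ C` up to factors depending only on `d` and `α`. -/
theorem strichartz_iff_nu0_square_function (d : ℕ) (hd : 0 < d)
    (α : ℝ) (hα0 : 0 < α) (hα1 : α < 1) :
    ∃ K : ℝ, 0 < K ∧
      ∀ f : EuclideanSpace ℝ (Fin d) → ℝ, Measurable f →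
        LocallyIntegrable (fun x => (f x) ^ 2) volume →
        ∀ B : ℝ, 0 ≤ B →
        (((∀ (z : EuclideanSpace ℝ (Fin d)) (R : ℝ), 0 < R →
            (∫⁻ x in ball z R, ∫⁻ y in ball z R,
              ENNReal.ofReal (|f x - f y| ^ 2 / ‖x - y‖ ^ ((d : ℝ) + 2 * α)))
              ≤ ENNReal.ofReal (B ^ 2 * R ^ (d : ℕ))) →
          (∀ (z : EuclideanSpace ℝ (Fin d)) (R : ℝ), 0 < R →
            (∫⁻ r in Set.Ioo (0 : ℝ) R,
              (∫⁻ x in ball z R,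
                ENNReal.ofReal ((nu0 d f x r / r ^ (α - 1)) ^ 2)) / ENNReal.ofReal r)
              ≤ ENNReal.ofReal (K * B ^ 2 * R ^ (d : ℕ)))) ∧
        ((∀ (z : EuclideanSpace ℝ (Fin d)) (R : ℝ), 0 < R →
            (∫⁻ r in Set.Ioo (0 : ℝ) R,
              (∫⁻ x in ball z R,
                ENNReal.ofReal ((nu0 d f x r / r ^ (α - 1)) ^ 2)) / ENNReal.ofReal r)
              ≤ ENNReal.ofReal (B * R ^ (d : ℕ))) →
          (∀ (z : EuclideanSpace ℝ (Fin d)) (R : ℝ), 0 < R →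
            (∫⁻ x in ball z R, ∫⁻ y in ball z R,
              ENNReal.ofReal (|f x - f y| ^ 2 / ‖x - y‖ ^ ((d : ℝ) + 2 * α)))
              ≤ ENNReal.ofReal (K * B * R ^ (d : ℕ))))) := by
  have hv := unitBallVolume_pos (d := d)
  have hK₁ : 0 < 2 ^ ((d : ℝ) + 2 * α) / ((d + 2 * α) * unitBallVolume d) := by positivity
  have hK₂ : 0 < 4 * unitBallVolume d * 2 ^ (2 * α + 1 + 3 * d) := by positivity
  set K₁ : ℝ := 2 ^ ((d : ℝ) + 2 * α) / ((d + 2 * α) * unitBallVolume d) with hK₁_def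
  set K₂ : ℝ := 4 * unitBallVolume d * 2 ^ (2 * α + 1 + 3 * d) with hK₂_def
  refine ⟨K₁ * 2 ^ d + K₂ * 4 ^ d, by positivity, fun f hf hf2 B hB => ⟨fun h z R hR => ?_,
    fun h z R hR => ?_⟩⟩
  · refine (square_function_le_strichartz hf hf2 hα0 z R).trans ?_
    refine (mul_le_mul_right (h z (2 * R) (by positivity)) _).trans ?_
    rw [← hK₁_def, ← ENNReal.ofReal_mul hK₁.le]
    refine ENNReal.ofReal_le_ofReal ?_
    have : 0 ≤ K₂ * 4 ^ d * B ^ 2 * R ^ d := by positivity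
    rw [mul_pow]
    linarith
  · refine (strichartz_le_square_function hf hf2 hα0 z R).trans ?_
    refine (mul_le_mul_right (h z (4 * R) (by positivity)) _).trans ?_
    rw [← hK₂_def, ← ENNReal.ofReal_mul hK₂.le]
    refine ENNReal.ofReal_le_ofReal ?_
    have : 0 ≤ K₁ * 2 ^ d * B * R ^ d := by positivity
    rw [mul_pow]
    linarith
end

section
/- Fix d ≥ 1 and an integer l ≥ 0. Let S_l denote the subspace of Schwartz functions φ on ℝ^d such that ∫ x^γ φ(x) dx = 0 for every multi-index γ with |γ| ≤ l, equipped with the subspace topology inherited from the Schwartz space. Let S : S'(ℝ^d) → (S_l)^* be the map sending a tempered distribution to its restriction to S_l. Then: (i) S is surjective, i.e. every continuous linear functional on S_l extends to a tempered distribution; and (ii) the kernel of S is exactly the set of tempered distributions given by integration against a polynomial of degree at most l. Consequently the dual of S_l is identified with tempered distributions modulo polynomials of degree at most l. -/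
open MeasureTheory

lemma abs_apply_le_norm {d : ℕ} (x : EuclideanSpace ℝ (Fin d)) (i : Fin d) : |x i| ≤ ‖x‖ := by
  rw [EuclideanSpace.norm_eq x, show |x i| = Real.sqrt ((x i) ^ 2) by rw [Real.sqrt_sq_eq_abs]]
  apply Real.sqrt_le_sqrt
  calc (x i) ^ 2 = ‖x i‖ ^ 2 := by rw [Real.norm_eq_abs, sq_abs]
    _ ≤ ∑ k : Fin d, ‖x k‖ ^ 2 :=
        Finset.single_le_sum (f := fun k => ‖x k‖ ^ 2) (fun k _ => by positivity)
          (Finset.mem_univ i)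

lemma integrable_monomial_mul_schwartz (d : ℕ) (γ : Fin d → ℕ)
    (φ : SchwartzMap (EuclideanSpace ℝ (Fin d)) ℝ) :
    Integrable (fun x : EuclideanSpace ℝ (Fin d) => (∏ i, x i ^ γ i) * φ x) := by
  have h := φ.integrable_pow_mul (μ := volume) (∑ i, γ i)
  refine h.mono' ?_ ?_
  · exact (Continuous.mul (by fun_prop) φ.continuous).aestronglyMeasurable
  · filter_upwards with x
    rw [Real.norm_eq_abs, abs_mul]
    have h1 : |∏ i, x i ^ γ i| ≤ ‖x‖ ^ ∑ i, γ i := by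
      rw [Finset.abs_prod]
      calc ∏ i, |x i ^ γ i| = ∏ i, |x i| ^ γ i := by simp [abs_pow]
        _ ≤ ∏ i, ‖x‖ ^ γ i :=
            Finset.prod_le_prod (fun i _ => by positivity)
              (fun i _ => pow_le_pow_left₀ (abs_nonneg _) (abs_apply_le_norm x i) _)
        _ = ‖x‖ ^ ∑ i, γ i := by rw [Finset.prod_pow_eq_pow_sum]
    have h2 : |φ x| = ‖φ x‖ := (Real.norm_eq_abs _).symm
    calc |∏ i, x i ^ γ i| * |φ x| ≤ (‖x‖ ^ ∑ i, γ i) * |φ x| :=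
          mul_le_mul_of_nonneg_right h1 (abs_nonneg _)
      _ = ‖x‖ ^ (∑ i, γ i) * ‖φ x‖ := by rw [h2]

/-- The subspace `S_l` of Schwartz functions all of whose moments of degree at most `l`
vanish. -/
noncomputable def momentsVanish (d l : ℕ) : Submodule ℝ (SchwartzMap (EuclideanSpace ℝ (Fin d)) ℝ) where
  carrier := {φ | ∀ γ : Fin d → ℕ, (∑ i, γ i) ≤ l → (∫ x, (∏ i, x i ^ γ i) * φ x) = 0}
  add_mem' := by
    intro φ ψ hφ hψ γ hγ
    have heq : (fun x : EuclideanSpace ℝ (Fin d) => (∏ i, x i ^ γ i) * (φ + ψ) x) =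
        fun x => (∏ i, x i ^ γ i) * φ x + (∏ i, x i ^ γ i) * ψ x := by
      funext x
      simp only [SchwartzMap.add_apply]
      ring
    simp only [Set.mem_setOf_eq] at *
    rw [show (∫ x, (∏ i, x i ^ γ i) * (φ + ψ) x) =
        ∫ x, ((∏ i, x i ^ γ i) * φ x + (∏ i, x i ^ γ i) * ψ x) by rw [heq]]
    rw [integral_add (integrable_monomial_mul_schwartz d γ φ)
      (integrable_monomial_mul_schwartz d γ ψ), hφ γ hγ, hψ γ hγ, add_zero]
  zero_mem' := by
    intro γ hγ
    simp
  smul_mem' := by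
    intro c φ hφ γ hγ
    have heq : (fun x : EuclideanSpace ℝ (Fin d) => (∏ i, x i ^ γ i) * (c • φ) x) =
        fun x => c • ((∏ i, x i ^ γ i) * φ x) := by
      funext x
      simp only [SchwartzMap.smul_apply, smul_eq_mul]
      ring
    simp only [Set.mem_setOf_eq] at *
    rw [show (∫ x, (∏ i, x i ^ γ i) * (c • φ) x) =
        ∫ x, c • ((∏ i, x i ^ γ i) * φ x) by rw [heq]]
    rw [integral_smul, hφ γ hγ, smul_zero]

/-- The moment of order `γ`, as a linear functional on Schwartz functions. -/
noncomputable def schwartzMoment (d : ℕ) (γ : Fin d → ℕ) :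
    SchwartzMap (EuclideanSpace ℝ (Fin d)) ℝ →ₗ[ℝ] ℝ where
  toFun φ := ∫ x, (∏ i, x i ^ γ i) * φ x
  map_add' φ ψ := by
    simp only [add_apply, mul_add]
    exact integral_add (integrable_monomial_mul_schwartz d γ φ)
      (integrable_monomial_mul_schwartz d γ ψ)
  map_smul' c φ := by
    simp only [smul_apply, smul_eq_mul, mul_left_comm _ c, RingHom.id_apply]
    exact integral_const_mul c _

lemma schwartzMoment_apply (d : ℕ) (γ : Fin d → ℕ)
    (φ : SchwartzMap (EuclideanSpace ℝ (Fin d)) ℝ) :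
    schwartzMoment d γ φ = ∫ x, (∏ i, x i ^ γ i) * φ x := rfl

lemma integral_eval_mul_schwartz (d : ℕ) (p : MvPolynomial (Fin d) ℝ)
    (φ : SchwartzMap (EuclideanSpace ℝ (Fin d)) ℝ) :
    ∫ x, MvPolynomial.eval (fun i => x i) p * φ x =
      ∑ γ ∈ p.support, p.coeff γ * schwartzMoment d γ φ := by
  simp only [MvPolynomial.eval_eq', Finset.sum_mul, mul_assoc, schwartzMoment_apply]
  rw [integral_finsetSum _ fun (γ : Fin d →₀ ℕ) _ =>
    (integrable_monomial_mul_schwartz d γ φ).const_mul _]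
  simp only [integral_const_mul]

lemma integral_eval_monomial_mul_schwartz (d : ℕ) (γ : Fin d →₀ ℕ) (c : ℝ)
    (φ : SchwartzMap (EuclideanSpace ℝ (Fin d)) ℝ) :
    ∫ x, MvPolynomial.eval (fun i => x i) (MvPolynomial.monomial γ c) * φ x =
      c * schwartzMoment d γ φ := by
  simp only [MvPolynomial.eval_monomial, Finsupp.prod_pow, mul_assoc, integral_const_mul,
    schwartzMoment_apply]

lemma integrable_eval_mul_schwartz (d : ℕ) (p : MvPolynomial (Fin d) ℝ)
    (φ : SchwartzMap (EuclideanSpace ℝ (Fin d)) ℝ) :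
    Integrable fun x : EuclideanSpace ℝ (Fin d) =>
      MvPolynomial.eval (fun i => x i) p * φ x := by
  simp only [MvPolynomial.eval_eq', Finset.sum_mul, mul_assoc]
  exact integrable_finsetSum _ fun γ _ => (integrable_monomial_mul_schwartz d γ φ).const_mul _

/-- There are finitely many multi-indices of order at most `l`. -/
lemma finite_sum_le (d l : ℕ) : {γ : Fin d → ℕ | ∑ i, γ i ≤ l}.Finite :=
  (Set.finite_Iic fun _ : Fin d => l).subset fun _ hγ i =>
    (Finset.single_le_sum (fun _ _ => Nat.zero_le _) (Finset.mem_univ i)).trans hγ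

lemma exists_polynomial_of_forall_momentsVanish (d l : ℕ)
    (U : SchwartzMap (EuclideanSpace ℝ (Fin d)) ℝ →ₗ[ℝ] ℝ)
    (hU : ∀ φ ∈ momentsVanish d l, U φ = 0) :
    ∃ p : MvPolynomial (Fin d) ℝ, p.totalDegree ≤ l ∧
      ∀ φ : SchwartzMap (EuclideanSpace ℝ (Fin d)) ℝ,
        U φ = ∫ x, MvPolynomial.eval (fun i => x i) p * φ x := by
  have := (finite_sum_le d l).fintype
  have hspan : U ∈ Submodule.span ℝ
      (Set.range fun γ : {γ : Fin d → ℕ | ∑ i, γ i ≤ l} => schwartzMoment d γ) := by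
    refine mem_span_of_iInf_ker_le_ker fun φ hφ => hU φ fun γ hγ => ?_
    simp only [Submodule.mem_iInf, LinearMap.mem_ker] at hφ
    exact hφ ⟨γ, hγ⟩
  obtain ⟨c, rfl⟩ := (Submodule.mem_span_range_iff_exists_fun ℝ).1 hspan
  refine ⟨∑ γ, MvPolynomial.monomial (Finsupp.equivFunOnFinite.symm γ.1) (c γ),
    MvPolynomial.totalDegree_finsetSum_le fun γ _ =>
      (MvPolynomial.totalDegree_monomial_le _ _).trans ?_, fun φ => ?_⟩
  · rw [Finsupp.sum_fintype _ _ fun _ => rfl]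
    exact γ.2
  · simp only [map_sum, Finset.sum_mul]
    rw [integral_finsetSum _ fun γ _ => integrable_eval_mul_schwartz d _ φ]
    simp [integral_eval_monomial_mul_schwartz]

/-- The restriction map from tempered distributions to continuous linear
functionals on `S_l` is surjective, and its kernel consists exactly of the (distributions
given by integration against) polynomials of degree at most `l`; hence the dual of `S_l` is
identified with tempered distributions modulo polynomials of degree at most `l`. -/
theorem dual_of_moment_vanishing_schwartz (d l : ℕ) (hd : 0 < d) :
    (∀ u : (momentsVanish d l) →L[ℝ] ℝ,
        ∃ U : SchwartzMap (EuclideanSpace ℝ (Fin d)) ℝ →L[ℝ] ℝ,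
          ∀ φ : momentsVanish d l, U (φ : SchwartzMap (EuclideanSpace ℝ (Fin d)) ℝ) = u φ) ∧
    (∀ U : SchwartzMap (EuclideanSpace ℝ (Fin d)) ℝ →L[ℝ] ℝ,
        ((∀ φ : SchwartzMap (EuclideanSpace ℝ (Fin d)) ℝ, φ ∈ momentsVanish d l → U φ = 0) ↔
          ∃ p : MvPolynomial (Fin d) ℝ, p.totalDegree ≤ l ∧
            ∀ φ : SchwartzMap (EuclideanSpace ℝ (Fin d)) ℝ,
              U φ = ∫ x, MvPolynomial.eval (fun i => x i) p * φ x)) := by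
  refine ⟨fun u => ?_, fun U => ⟨exists_polynomial_of_forall_momentsVanish d l U.toLinearMap, ?_⟩⟩
  · have := (schwartz_withSeminorms ℝ (EuclideanSpace ℝ (Fin d)) ℝ).toPolynormableSpace
    exact StrongDual.exists_extension (momentsVanish d l) u
  · rintro ⟨p, hp, hU⟩ φ hφ
    rw [hU, integral_eval_mul_schwartz]
    refine Finset.sum_eq_zero fun γ hγ => ?_
    have hγl : ∑ i, γ i ≤ l := by
      rw [← Finsupp.sum_fintype γ (fun _ e => e) fun _ => rfl]
      exact (MvPolynomial.le_totalDegree hγ).trans hp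
    rw [schwartzMoment_apply, hφ γ hγl, mul_zero]
end

section
/- Fix d ≥ 1 and an integer l ≥ 0. Suppose u is a tempered distribution on ℝ^d such that u(φ) = 0 for every Schwartz function φ satisfying ∫ x^γ φ(x) dx = 0 for all multi-indices γ with |γ| ≤ l. Then there exists a polynomial p on ℝ^d of degree at most l such that u(φ) = ∫ p(x) φ(x) dx for every Schwartz function φ. -/
open MeasureTheory

/-- A Schwartz function times a monomial is integrable. -/
theorem SchwartzMap.integrable_monomial_mul {d : ℕ} (γ : Fin d → ℕ)
    (φ : SchwartzMap (EuclideanSpace ℝ (Fin d)) ℝ) :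
    Integrable (fun x : EuclideanSpace ℝ (Fin d) => (∏ i, x i ^ γ i) * φ x) := by
  refine (φ.integrable_pow_mul volume (∑ i, γ i)).mono' ?_ (.of_forall fun x => ?_)
  · have hc : Continuous fun x : EuclideanSpace ℝ (Fin d) => (∏ i, x i ^ γ i) * φ x :=
      (by fun_prop : Continuous fun x : EuclideanSpace ℝ (Fin d) => ∏ i, x i ^ γ i).mul
        φ.continuous
    exact hc.aestronglyMeasurable
  · rw [norm_mul, norm_prod, ← Finset.prod_pow_eq_pow_sum]
    gcongr with i _
    rw [norm_pow]
    gcongr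
    exact PiLp.norm_apply_le x i

/-- The moment functional `φ ↦ ∫ x ^ γ φ(x) dx` on Schwartz functions. -/
noncomputable def SchwartzMap.moment {d : ℕ} (γ : Fin d → ℕ) :
    SchwartzMap (EuclideanSpace ℝ (Fin d)) ℝ →ₗ[ℝ] ℝ where
  toFun φ := ∫ x, (∏ i, x i ^ γ i) * φ x
  map_add' φ ψ := by
    simp only [add_apply, mul_add]
    exact integral_add (φ.integrable_monomial_mul γ) (ψ.integrable_monomial_mul γ)
  map_smul' c φ := by
    simp only [smul_apply, smul_eq_mul, mul_left_comm _ c, integral_const_mul,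
      RingHom.id_apply]

/-- A tempered distribution on `ℝ^d` vanishing on every Schwartz function
whose moments of degree at most `l` all vanish is given by integration against a polynomial
of degree at most `l`. -/
theorem tempered_distribution_vanishing_on_moment_free_is_polynomial
    (d l : ℕ) (hd : 0 < d)
    (u : SchwartzMap (EuclideanSpace ℝ (Fin d)) ℝ →L[ℝ] ℝ)
    (hu : ∀ φ : SchwartzMap (EuclideanSpace ℝ (Fin d)) ℝ,
      (∀ γ : Fin d → ℕ, (∑ i, γ i) ≤ l → (∫ x, (∏ i, x i ^ γ i) * φ x) = 0) → u φ = 0) :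
    ∃ p : MvPolynomial (Fin d) ℝ, p.totalDegree ≤ l ∧
      ∀ φ : SchwartzMap (EuclideanSpace ℝ (Fin d)) ℝ,
        u φ = ∫ x, MvPolynomial.eval (fun i => x i) p * φ x := by
  have hfin : {γ : Fin d → ℕ | ∑ i, γ i ≤ l}.Finite :=
    (Set.finite_Iic fun _ => l).subset fun γ (hγ : ∑ i, γ i ≤ l) i =>
      (Finset.single_le_sum (fun _ _ => Nat.zero_le _) (Finset.mem_univ i)).trans hγ
  have := hfin.fintype
  have hspan : u.toLinearMap ∈ Submodule.span ℝ
      (Set.range fun γ : {γ : Fin d → ℕ | ∑ i, γ i ≤ l} => SchwartzMap.moment γ.1) := by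
    refine mem_span_of_iInf_ker_le_ker fun φ hφ => hu φ fun γ hγ => ?_
    exact (Submodule.mem_iInf _).1 hφ ⟨γ, hγ⟩
  obtain ⟨c, hc⟩ := (Submodule.mem_span_range_iff_exists_fun ℝ).1 hspan
  refine ⟨∑ γ, MvPolynomial.monomial (Finsupp.equivFunOnFinite.symm γ.1) (c γ),
    MvPolynomial.totalDegree_finsetSum_le fun γ _ => ?_, fun φ => ?_⟩
  · refine (MvPolynomial.totalDegree_monomial_le _ _).trans ?_
    rw [Finsupp.sum_fintype _ _ fun _ => rfl]
    exact γ.2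
  · have hφ : u φ = ∑ γ, c γ * ∫ x, (∏ i, x i ^ γ.1 i) * φ x := by
      have := LinearMap.congr_fun hc φ
      simpa [SchwartzMap.moment] using this.symm
    simp only [hφ, map_sum, MvPolynomial.eval_monomial, Finsupp.prod_pow,
      Finsupp.equivFunOnFinite_symm_apply_apply, Finset.sum_mul, mul_assoc]
    rw [integral_finsetSum _ fun γ _ => (φ.integrable_monomial_mul γ.1).const_mul (c γ)]
    simp only [integral_const_mul]
end

section
/- Let d ≥ 1 and let b : ℝ^d → ℝ be locally integrable with ‖b‖_* < ∞. Then there exists a constant C depending only on d such that for every Schwartz function φ on ℝ^d with ∫ φ(x) dx = 0, the integral ∫ b(x) φ(x) dx converges absolutely and |∫ b(x) φ(x) dx| ≤ C ‖b‖_* · sup_{x ∈ ℝ^d} (1 + |x|)^{d+1} |φ(x)|. In particular, b defines a continuous linear functional on the space of Schwartz functions with vanishing integral. -/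
open MeasureTheory Metric

/-- The summable majorant `2⁻ᵏ (1 + k D)` which controls the dyadic shells. -/
lemma summable_half_pow_mul_one_add (D : ℝ) :
    Summable fun k : ℕ => (1 / 2 : ℝ) ^ k * (1 + k * D) := by
  have h0 : Summable fun k : ℕ => (1 / 2 : ℝ) ^ k :=
    summable_geometric_of_lt_one (by norm_num) (by norm_num)
  have h1 : Summable fun k : ℕ => (k : ℝ) ^ 1 * (1 / 2 : ℝ) ^ k :=
    summable_pow_mul_geometric_of_norm_lt_one 1 (by norm_num)
  refine (h0.add (h1.mul_right D)).congr fun k => ?_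
  ring

lemma inv_one_add_pow_le_dyadic {t : ℝ} (ht : 0 ≤ t) (n : ℕ) :
    ∃ k : ℕ, t < 2 ^ k ∧ ((1 + t) ^ n)⁻¹ ≤ 2 ^ n * ((2 ^ k) ^ n)⁻¹ := by
  classical
  have hex : ∃ k : ℕ, t < 2 ^ k := pow_unbounded_of_one_lt t one_lt_two
  refine ⟨Nat.find hex, Nat.find_spec hex, ?_⟩
  have key : (2 : ℝ) ^ Nat.find hex ≤ 2 * (1 + t) := by
    rcases h : Nat.find hex with _ | m
    · norm_num; linarith
    · have := Nat.find_min hex (m := m) (by omega)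
      rw [pow_succ]
      linarith
  rw [inv_le_comm₀ (by positivity) (by positivity), mul_inv, inv_inv, ← inv_pow, ← mul_pow]
  gcongr
  linarith

section MeanOscillation

variable {d : ℕ} {M : ℝ} {b : EuclideanSpace ℝ (Fin d) → ℝ}

lemma measureReal_ball_two_pow (d k : ℕ) :
    volume.real (ball (0 : EuclideanSpace ℝ (Fin d)) (2 ^ k)) =
      (2 ^ k) ^ d * volume.real (ball (0 : EuclideanSpace ℝ (Fin d)) 1) := by
  have := Measure.addHaar_ball_of_pos (volume : Measure (EuclideanSpace ℝ (Fin d))) 0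
    (r := 2 ^ k) (by positivity)
  rw [measureReal_def, this, finrank_euclideanSpace_fin, ENNReal.toReal_mul,
    ENNReal.toReal_ofReal (by positivity), measureReal_def]

lemma measureReal_ball_pos (x : EuclideanSpace ℝ (Fin d)) {r : ℝ} (hr : 0 < r) :
    0 < volume.real (ball x r) :=
  ENNReal.toReal_pos (measure_ball_pos volume x hr).ne' measure_ball_lt_top.ne

lemma integrableOn_ball_abs_sub_const (hb : LocallyIntegrable b volume)
    (x : EuclideanSpace ℝ (Fin d)) (r c : ℝ) :
    IntegrableOn (fun y => |b y - c|) (ball x r) := by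
  have h : IntegrableOn b (ball x r) :=
    (hb.integrableOn_isCompact (isCompact_closedBall x r)).mono_set ball_subset_closedBall
  exact (h.sub (integrableOn_const measure_ball_lt_top.ne)).abs

lemma setIntegral_abs_sub_average_le
    (hM : ∀ (x : EuclideanSpace ℝ (Fin d)) (r : ℝ), 0 < r →
      ⨍ y in ball x r, |b y - ⨍ w in ball x r, b w| ≤ M)
    (x : EuclideanSpace ℝ (Fin d)) {r : ℝ} (hr : 0 < r) :
    ∫ y in ball x r, |b y - ⨍ w in ball x r, b w| ≤ volume.real (ball x r) * M := by
  have h := hM x r hr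
  rw [setAverage_eq, smul_eq_mul, inv_mul_le_iff₀ (measureReal_ball_pos x hr)] at h
  exact h

lemma measureReal_mul_abs_average_sub_le (hb : LocallyIntegrable b volume)
    (x : EuclideanSpace ℝ (Fin d)) {r : ℝ} (hr : 0 < r) (c : ℝ) :
    volume.real (ball x r) * |(⨍ w in ball x r, b w) - c| ≤ ∫ y in ball x r, |b y - c| := by
  have hv := measureReal_ball_pos x hr
  have h : IntegrableOn b (ball x r) :=
    (hb.integrableOn_isCompact (isCompact_closedBall x r)).mono_set ball_subset_closedBall
  have e : volume.real (ball x r) * ((⨍ w in ball x r, b w) - c) = ∫ y in ball x r, (b y - c) := by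
    rw [integral_sub h (integrableOn_const measure_ball_lt_top.ne), setAverage_eq,
      setIntegral_const, smul_eq_mul, smul_eq_mul]
    field_simp
  rw [← abs_of_pos hv, ← abs_mul, e]
  exact abs_integral_le_integral_abs

lemma abs_average_ball_two_pow_succ_sub_le (hb : LocallyIntegrable b volume)
    (hM : ∀ (x : EuclideanSpace ℝ (Fin d)) (r : ℝ), 0 < r →
      ⨍ y in ball x r, |b y - ⨍ w in ball x r, b w| ≤ M) (k : ℕ) :
    |(⨍ w in ball 0 (2 ^ (k + 1)), b w) - ⨍ w in ball 0 (2 ^ k), b w| ≤ 2 ^ d * M := by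
  have hv := measureReal_ball_pos (0 : EuclideanSpace ℝ (Fin d)) (r := 2 ^ k) (by positivity)
  have h1 := measureReal_mul_abs_average_sub_le hb 0 (r := 2 ^ k) (by positivity)
    (⨍ w in ball 0 (2 ^ (k + 1)), b w)
  have h2 := setIntegral_abs_sub_average_le hM 0 (r := 2 ^ (k + 1)) (by positivity)
  have h3 := setIntegral_mono_set
    (integrableOn_ball_abs_sub_const hb 0 (2 ^ (k + 1))
      (⨍ w in ball 0 (2 ^ (k + 1)), b w))
    (Filter.Eventually.of_forall fun _ => abs_nonneg _)
    (ball_subset_ball (x := (0 : EuclideanSpace ℝ (Fin d)))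
      (pow_le_pow_right₀ one_le_two k.le_succ : (2 : ℝ) ^ k ≤ 2 ^ (k + 1))).eventuallyLE
  have h4 : volume.real (ball (0 : EuclideanSpace ℝ (Fin d)) (2 ^ (k + 1))) * M =
      volume.real (ball (0 : EuclideanSpace ℝ (Fin d)) (2 ^ k)) * (2 ^ d * M) := by
    rw [measureReal_ball_two_pow, measureReal_ball_two_pow, pow_succ, mul_pow]
    ring
  rw [abs_sub_comm]
  exact le_of_mul_le_mul_left (((h1.trans h3).trans h2).trans h4.le) hv

lemma abs_average_ball_two_pow_sub_le (hb : LocallyIntegrable b volume)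
    (hM : ∀ (x : EuclideanSpace ℝ (Fin d)) (r : ℝ), 0 < r →
      ⨍ y in ball x r, |b y - ⨍ w in ball x r, b w| ≤ M) (k : ℕ) :
    |(⨍ w in ball 0 (2 ^ k), b w) - ⨍ w in ball 0 1, b w| ≤ k * (2 ^ d * M) := by
  induction k with
  | zero => simp
  | succ k ih =>
    have h := abs_average_ball_two_pow_succ_sub_le hb hM k
    have t := abs_sub_le (⨍ w in ball 0 (2 ^ (k + 1)), b w) (⨍ w in ball 0 (2 ^ k), b w)
      (⨍ w in ball 0 1, b w)
    push_cast
    linarith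

lemma setIntegral_ball_two_pow_abs_sub_le (hb : LocallyIntegrable b volume)
    (hM : ∀ (x : EuclideanSpace ℝ (Fin d)) (r : ℝ), 0 < r →
      ⨍ y in ball x r, |b y - ⨍ w in ball x r, b w| ≤ M) (k : ℕ) :
    ∫ y in ball 0 (2 ^ k), |b y - ⨍ w in ball 0 1, b w| ≤
      (2 ^ k) ^ d * volume.real (ball (0 : EuclideanSpace ℝ (Fin d)) 1) *
        (M * (1 + k * 2 ^ d)) := by
  have hi := integrableOn_ball_abs_sub_const hb 0 (2 ^ k)
    (⨍ w in ball 0 (2 ^ k), b w)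
  have hc : IntegrableOn (fun _ : EuclideanSpace ℝ (Fin d) => k * (2 ^ d * M))
      (ball 0 (2 ^ k)) := integrableOn_const measure_ball_lt_top.ne
  calc ∫ y in ball 0 (2 ^ k), |b y - ⨍ w in ball 0 1, b w|
      ≤ ∫ y in ball 0 (2 ^ k), (|b y - ⨍ w in ball 0 (2 ^ k), b w| + k * (2 ^ d * M)) := by
        refine setIntegral_mono (integrableOn_ball_abs_sub_const hb _ _ _)
          (hi.add hc) fun y => ?_
        have := abs_sub_le (b y) (⨍ w in ball 0 (2 ^ k), b w) (⨍ w in ball 0 1, b w)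
        linarith [abs_average_ball_two_pow_sub_le hb hM k]
    _ ≤ _ := by
        rw [integral_add hi hc, setIntegral_const, smul_eq_mul, ← measureReal_ball_two_pow]
        have := setIntegral_abs_sub_average_le hM 0 (r := 2 ^ k) (by positivity)
        linarith

lemma lintegral_abs_sub_average_mul_inv_pow_le (hb : LocallyIntegrable b volume) (hM0 : 0 ≤ M)
    (hM : ∀ (x : EuclideanSpace ℝ (Fin d)) (r : ℝ), 0 < r →
      ⨍ y in ball x r, |b y - ⨍ w in ball x r, b w| ≤ M) :
    ∫⁻ x, ENNReal.ofReal (|b x - ⨍ w in ball 0 1, b w| * ((1 + ‖x‖) ^ (d + 1))⁻¹) ≤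
      ENNReal.ofReal (2 ^ (d + 1) * volume.real (ball (0 : EuclideanSpace ℝ (Fin d)) 1) *
        (∑' k : ℕ, (1 / 2 : ℝ) ^ k * (1 + k * 2 ^ d)) * M) := by
  set c := ⨍ w in ball 0 1, b w
  have hmeas : AEMeasurable (fun x => |b x - c|) volume := by
    have := hb.aestronglyMeasurable.aemeasurable
    fun_prop
  let a : ℕ → ℝ := fun k => 2 ^ (d + 1) * ((2 ^ k) ^ (d + 1))⁻¹
  have ha : ∀ k, 0 ≤ a k := fun k => by positivity
  calc ∫⁻ x, ENNReal.ofReal (|b x - c| * ((1 + ‖x‖) ^ (d + 1))⁻¹)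
      ≤ ∫⁻ x, ∑' k : ℕ, (ball (0 : EuclideanSpace ℝ (Fin d)) (2 ^ k)).indicator
          (fun x => ENNReal.ofReal (a k) * ENNReal.ofReal |b x - c|) x := by
        refine lintegral_mono fun x => ?_
        obtain ⟨k, hk, hle⟩ := inv_one_add_pow_le_dyadic (norm_nonneg x) (d + 1)
        refine le_trans ?_ (ENNReal.le_tsum k)
        rw [Set.indicator_of_mem (by simpa using hk), ← ENNReal.ofReal_mul (ha k), mul_comm]
        exact ENNReal.ofReal_le_ofReal (mul_le_mul_of_nonneg_right hle (abs_nonneg _))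
    _ = ∑' k : ℕ, ENNReal.ofReal (a k) * ∫⁻ x in ball 0 (2 ^ k), ENNReal.ofReal |b x - c| := by
        rw [lintegral_tsum fun k => (hmeas.ennreal_ofReal.const_mul _).indicator measurableSet_ball]
        refine tsum_congr fun k => ?_
        rw [lintegral_indicator measurableSet_ball,
          lintegral_const_mul' _ _ ENNReal.ofReal_ne_top]
    _ ≤ ∑' k : ℕ, ENNReal.ofReal (2 ^ (d + 1) *
          volume.real (ball (0 : EuclideanSpace ℝ (Fin d)) 1) *
          ((1 / 2 : ℝ) ^ k * (1 + k * 2 ^ d)) * M) := by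
        refine ENNReal.tsum_le_tsum fun k => ?_
        rw [← ofReal_integral_eq_lintegral_ofReal
          (integrableOn_ball_abs_sub_const hb _ _ _)
          (Filter.Eventually.of_forall fun _ => abs_nonneg _), ← ENNReal.ofReal_mul (ha k)]
        refine ENNReal.ofReal_le_ofReal ((mul_le_mul_of_nonneg_left
          (setIntegral_ball_two_pow_abs_sub_le hb hM k) (ha k)).trans_eq ?_)
        have : ((2 : ℝ) ^ k) ^ (d + 1) = (2 ^ k) ^ d * 2 ^ k := pow_succ _ _
        simp only [a, this, one_div, inv_pow]
        field_simp
    _ = _ := by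
        rw [← ENNReal.ofReal_tsum_of_nonneg (fun k => by positivity)
          (((summable_half_pow_mul_one_add _).mul_left _).mul_right _), tsum_mul_right,
          tsum_mul_left]

end MeanOscillation

lemma SchwartzMap.bddAbove_one_add_norm_pow_mul_abs {d : ℕ}
    (φ : SchwartzMap (EuclideanSpace ℝ (Fin d)) ℝ) (n : ℕ) :
    BddAbove (Set.range fun x => (1 + ‖x‖) ^ n * |φ x|) := by
  refine ⟨2 ^ n * ((Finset.Iic (n, 0)).sup fun m => SchwartzMap.seminorm ℝ m.1 m.2) φ, ?_⟩
  rintro _ ⟨x, rfl⟩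
  simpa using SchwartzMap.one_add_le_sup_seminorm_apply (𝕜 := ℝ) (m := (n, 0)) le_rfl le_rfl φ x

/-- A locally integrable function `b` with BMO seminorm at most `M` pairs
absolutely convergently with every mean-zero Schwartz function `φ`, with
`|∫ b φ| ≤ C M · sup_x (1+|x|)^{d+1} |φ(x)|`, where `C` depends only on `d`.  In particular `b`
defines a continuous linear functional on mean-zero Schwartz functions. -/
theorem bmo_pairs_with_mean_zero_schwartz (d : ℕ) (hd : 0 < d) :
    ∃ C : ℝ, 0 < C ∧
      ∀ (M : ℝ) (b : EuclideanSpace ℝ (Fin d) → ℝ), 0 ≤ M →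
        LocallyIntegrable b volume →
        (∀ (x : EuclideanSpace ℝ (Fin d)) (r : ℝ), 0 < r →
          ⨍ y in ball x r, |b y - ⨍ w in ball x r, b w| ≤ M) →
        ∀ φ : SchwartzMap (EuclideanSpace ℝ (Fin d)) ℝ, (∫ x, φ x) = 0 →
          Integrable (fun x => b x * φ x) ∧
          |∫ x, b x * φ x| ≤ C * M * ⨆ x : EuclideanSpace ℝ (Fin d),
            (1 + ‖x‖) ^ (d + 1) * |φ x| := by
  have hv := measureReal_ball_pos (0 : EuclideanSpace ℝ (Fin d)) one_pos
  have hS : 0 < ∑' k : ℕ, (1 / 2 : ℝ) ^ k * (1 + k * 2 ^ d) :=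
    (summable_half_pow_mul_one_add _).tsum_pos (fun k => by positivity) 0 (by norm_num)
  refine ⟨2 ^ (d + 1) * volume.real (ball (0 : EuclideanSpace ℝ (Fin d)) 1) *
    ∑' k : ℕ, (1 / 2 : ℝ) ^ k * (1 + k * 2 ^ d), by positivity, ?_⟩
  intro M b hM0 hb hM φ hφ
  have hL := lintegral_abs_sub_average_mul_inv_pow_le hb hM0 hM
  set K := 2 ^ (d + 1) * volume.real (ball (0 : EuclideanSpace ℝ (Fin d)) 1) *
    ∑' k : ℕ, (1 / 2 : ℝ) ^ k * (1 + k * 2 ^ d)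
  have hK : 0 ≤ K := by positivity
  set c := ⨍ w in ball 0 1, b w
  set N := ⨆ x : EuclideanSpace ℝ (Fin d), (1 + ‖x‖) ^ (d + 1) * |φ x|
  have hmeas : AEStronglyMeasurable (fun x => b x - c) volume :=
    hb.aestronglyMeasurable.sub aestronglyMeasurable_const
  have hφN : ∀ x, |φ x| ≤ N * ((1 + ‖x‖) ^ (d + 1))⁻¹ := fun x => by
    rw [← div_eq_mul_inv, le_div_iff₀' (by positivity)]
    exact le_ciSup (φ.bddAbove_one_add_norm_pow_mul_abs (d + 1)) x
  have hnn : ∀ x : EuclideanSpace ℝ (Fin d), 0 ≤ |b x - c| * ((1 + ‖x‖) ^ (d + 1))⁻¹ :=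
    fun x => by positivity
  have hwmeas : AEStronglyMeasurable
      (fun x : EuclideanSpace ℝ (Fin d) => |b x - c| * ((1 + ‖x‖) ^ (d + 1))⁻¹) volume := by
    have := hmeas.aemeasurable
    exact AEMeasurable.aestronglyMeasurable (by fun_prop)
  have hw : Integrable (fun x => |b x - c| * ((1 + ‖x‖) ^ (d + 1))⁻¹) :=
    ⟨hwmeas, (hasFiniteIntegral_iff_ofReal (Filter.Eventually.of_forall hnn)).2
      (hL.trans_lt ENNReal.ofReal_lt_top)⟩
  have hwK : ∫ x, |b x - c| * ((1 + ‖x‖) ^ (d + 1))⁻¹ ≤ K * M := by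
    rw [integral_eq_lintegral_of_nonneg_ae (Filter.Eventually.of_forall hnn) hwmeas]
    exact ENNReal.toReal_le_of_le_ofReal (by positivity) hL
  have hN : 0 ≤ N := Real.iSup_nonneg fun x => by positivity
  have hle : ∀ x, ‖(b x - c) * φ x‖ ≤ N * (|b x - c| * ((1 + ‖x‖) ^ (d + 1))⁻¹) := fun x => by
    rw [norm_mul, Real.norm_eq_abs, Real.norm_eq_abs]
    calc _ ≤ |b x - c| * (N * ((1 + ‖x‖) ^ (d + 1))⁻¹) :=
          mul_le_mul_of_nonneg_left (hφN x) (abs_nonneg _)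
      _ = _ := by ring
  have hint : Integrable fun x => (b x - c) * φ x :=
    (hw.const_mul N).mono' (hmeas.mul φ.integrable.aestronglyMeasurable)
      (Filter.Eventually.of_forall hle)
  have heq : (fun x => b x * φ x) = fun x => (b x - c) * φ x + c * φ x := by
    ext x; ring
  have hcφ : Integrable fun x => c * φ x := φ.integrable.const_mul c
  rw [heq]
  refine ⟨hint.add hcφ, ?_⟩
  rw [integral_add hint hcφ, integral_const_mul, hφ, mul_zero, add_zero, ← Real.norm_eq_abs]
  calc _ ≤ ∫ x, N * (|b x - c| * ((1 + ‖x‖) ^ (d + 1))⁻¹) :=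
        norm_integral_le_of_norm_le (hw.const_mul N) (Filter.Eventually.of_forall hle)
    _ ≤ N * (K * M) := by
        rw [integral_const_mul]
        exact mul_le_mul_of_nonneg_left hwK hN
    _ = K * M * N := by ring
end

section
/- Let d ≥ 1, 0 < α < 1, and let b : ℝ^d → ℝ be locally integrable with ‖b‖_* < ∞. Then: (i) for every y ∈ ℝ^d the integral F(y) := ∫_{ℝ^d} b(x) ( |x − y|^{α−d} − |x|^{α−d} ) dx converges absolutely; and (ii) for every Schwartz function φ on ℝ^d with ∫ φ = 0, the double integral ∫_{ℝ^d} b(x) ( ∫_{ℝ^d} φ(y) ( |x−y|^{α−d} − |x|^{α−d} ) dy ) dx converges absolutely and equals ∫_{ℝ^d} F(y) φ(y) dy. Consequently, for 0 < α < 1 the distribution I_α(b), defined on mean-zero Schwartz functions by pairing b with the Riesz potential I_α(φ), coincides with the function F. -/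
open MeasureTheory Metric

/-- The renormalized Riesz kernel `(x,y) ↦ |x−y|^{α−d} − |x|^{α−d}`. -/
noncomputable def rieszKernelDiff (d : ℕ) (α : ℝ) (x y : EuclideanSpace ℝ (Fin d)) : ℝ :=
  ‖x - y‖ ^ (α - (d : ℝ)) - ‖x‖ ^ (α - (d : ℝ))

/-- A product is integrable when its second factor is dominated on a countable cover by constants
that are summable against the masses of the first factor. -/
lemma integrable_mul_of_cover {X : Type*} [MeasurableSpace X] {μ : Measure X} {b g : X → ℝ}
    {S : ℕ → Set X} {c a : ℕ → ℝ} (hb : AEStronglyMeasurable b μ) (hg : Measurable g)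
    (hS : ∀ k, MeasurableSet (S k)) (hbS : ∀ k, IntegrableOn b (S k) μ)
    (ha : ∀ k, ∫ x in S k, |b x| ∂μ ≤ a k) (hc : ∀ k, 0 ≤ c k)
    (hsum : Summable fun k => c k * a k)
    (hcover : ∀ x, g x = 0 ∨ ∃ k, x ∈ S k ∧ |g x| ≤ c k) :
    Integrable (fun x => b x * g x) μ ∧ ∫ x, |b x * g x| ∂μ ≤ ∑' k, c k * a k := by
  have ha0 : ∀ k, 0 ≤ a k := fun k =>
    (integral_nonneg fun x => abs_nonneg (b x)).trans (ha k)
  have h0 : ∀ k, 0 ≤ c k * a k := fun k => mul_nonneg (hc k) (ha0 k)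
  have hm : AEStronglyMeasurable (fun x => b x * g x) μ := hb.mul hg.aestronglyMeasurable
  have key : ∫⁻ x, ‖b x * g x‖ₑ ∂μ ≤ ENNReal.ofReal (∑' k, c k * a k) := by
    calc ∫⁻ x, ‖b x * g x‖ₑ ∂μ
        ≤ ∫⁻ x, ∑' k, (S k).indicator (fun x => ENNReal.ofReal (c k) * ‖b x‖ₑ) x ∂μ := by
          refine lintegral_mono fun x => ?_
          rcases hcover x with hx | ⟨k, hk, hgk⟩
          · simp [hx]
          · refine le_trans ?_ (ENNReal.le_tsum k)
            rw [Set.indicator_of_mem hk, enorm_mul, mul_comm, Real.enorm_eq_ofReal_abs (g x)]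
            gcongr
      _ = ∑' k, ENNReal.ofReal (c k) * ∫⁻ x in S k, ‖b x‖ₑ ∂μ := by
          rw [lintegral_tsum fun k => (hb.enorm.const_mul _).indicator (hS k)]
          refine tsum_congr fun k => ?_
          rw [lintegral_indicator (hS k), lintegral_const_mul'' _ hb.enorm.restrict]
      _ ≤ ∑' k, ENNReal.ofReal (c k * a k) := by
          refine ENNReal.tsum_le_tsum fun k => ?_
          rw [ENNReal.ofReal_mul (hc k), ← ofReal_integral_norm_eq_lintegral_enorm (hbS k)]
          gcongr
          exact ha k
      _ = _ := (ENNReal.ofReal_tsum_of_nonneg h0 hsum).symm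
  refine ⟨⟨hm, key.trans_lt ENNReal.ofReal_lt_top⟩, ?_⟩
  have := integral_norm_eq_lintegral_enorm hm
  simp only [Real.norm_eq_abs] at this
  rw [this]
  exact ENNReal.toReal_le_of_le_ofReal (tsum_nonneg h0) key

lemma abs_setAverage_abs_sub_abs_le {X : Type*} [MeasurableSpace X] {μ : Measure X} {b : X → ℝ}
    {S : Set X} (hb : IntegrableOn b S μ) (h0 : μ S ≠ 0) (ht : μ S ≠ ⊤) (c : ℝ) :
    |(⨍ x in S, |b x| ∂μ) - (|c|)| ≤ ⨍ x in S, |b x - c| ∂μ := by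
  have hpos : 0 < μ.real S := ENNReal.toReal_pos h0 ht
  have hc : IntegrableOn (fun _ => c) S μ := integrableOn_const ht
  have hc' : IntegrableOn (fun _ => |c|) S μ := integrableOn_const ht
  have e : (⨍ x in S, |b x| ∂μ) - |c| = (μ.real S)⁻¹ * ∫ x in S, (|b x| - |c|) ∂μ := by
    rw [integral_sub hb.abs hc', setAverage_eq, setIntegral_const]
    simp only [smul_eq_mul]
    field_simp
  rw [e, setAverage_eq, abs_mul, abs_of_pos (inv_pos.2 hpos), smul_eq_mul]
  gcongr
  refine (abs_integral_le_integral_abs).trans ?_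
  exact integral_mono (hb.abs.sub hc').abs (hb.sub hc).abs fun x => abs_abs_sub_abs_le _ _

lemma volume_real_ball_euclidean {d : ℕ} (y : EuclideanSpace ℝ (Fin d)) {r : ℝ} (hr : 0 < r) :
    volume.real (ball y r) = r ^ d * volume.real (ball (0 : EuclideanSpace ℝ (Fin d)) 1) := by
  rw [Measure.real, Measure.addHaar_ball_of_pos _ _ hr, ENNReal.toReal_mul,
    ENNReal.toReal_ofReal (by positivity), finrank_euclideanSpace, Fintype.card_fin, Measure.real]

lemma volume_real_unitBall_pos (d : ℕ) :
    0 < volume.real (ball (0 : EuclideanSpace ℝ (Fin d)) 1) :=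
  ENNReal.toReal_pos (measure_ball_pos _ _ one_pos).ne' measure_ball_lt_top.ne

lemma MeasureTheory.LocallyIntegrable.integrableOn_ball {d : ℕ} {b : EuclideanSpace ℝ (Fin d) → ℝ}
    (hb : LocallyIntegrable b volume) (y : EuclideanSpace ℝ (Fin d)) (r : ℝ) :
    IntegrableOn b (ball y r) :=
  (hb.integrableOn_isCompact (isCompact_closedBall y r)).mono_set ball_subset_closedBall

section BMO

variable {d : ℕ} {M : ℝ} {b : EuclideanSpace ℝ (Fin d) → ℝ}

/-- Means of `|b|` over a ball and its double differ by a multiple of the BMO seminorm. -/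
lemma abs_ballMean_sub_ballMean_double_le (hb : LocallyIntegrable b volume)
    (hbmo : ∀ (x : EuclideanSpace ℝ (Fin d)) (r : ℝ), 0 < r →
      ⨍ y in ball x r, |b y - ⨍ w in ball x r, b w| ≤ M)
    (y : EuclideanSpace ℝ (Fin d)) {r : ℝ} (hr : 0 < r) :
    |(⨍ x in ball y r, |b x|) - (⨍ x in ball y (2 * r), |b x|)| ≤ (2 ^ d + 1) * M := by
  set c := ⨍ w in ball y (2 * r), b w
  have h2 := hbmo y (2 * r) (by positivity)
  have ha := abs_setAverage_abs_sub_abs_le (hb.integrableOn_ball y r)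
    (measure_ball_pos _ _ hr).ne' measure_ball_lt_top.ne c
  have hb2 := abs_setAverage_abs_sub_abs_le (hb.integrableOn_ball y (2 * r))
    (measure_ball_pos _ _ (by positivity)).ne' measure_ball_lt_top.ne c
  have hω := volume_real_unitBall_pos d
  have hle : ⨍ x in ball y r, |b x - c| ≤ 2 ^ d * ⨍ x in ball y (2 * r), |b x - c| := by
    rw [setAverage_eq, setAverage_eq, volume_real_ball_euclidean y hr,
      volume_real_ball_euclidean y (by positivity : 0 < 2 * r), smul_eq_mul, smul_eq_mul]
    have : ∫ x in ball y r, |b x - c| ≤ ∫ x in ball y (2 * r), |b x - c| := by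
      refine setIntegral_mono_set ?_ (ae_of_all _ fun x => abs_nonneg _)
        (ball_subset_ball (by linarith)).eventuallyLE
      exact ((hb.integrableOn_ball y (2 * r)).sub
        (integrableOn_const measure_ball_lt_top.ne)).abs
    calc _ ≤ (r ^ d * volume.real (ball (0 : EuclideanSpace ℝ (Fin d)) 1))⁻¹ *
          ∫ x in ball y (2 * r), |b x - c| := by gcongr
      _ = _ := by rw [mul_pow]; field_simp
  have hM : ⨍ x in ball y r, |b x - c| ≤ 2 ^ d * M := hle.trans (by gcongr)
  have h3 := abs_sub_le (⨍ x in ball y r, |b x|) |c| (⨍ x in ball y (2 * r), |b x|)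
  rw [abs_sub_comm |c|] at h3
  linarith

lemma ballMean_scale_le (hb : LocallyIntegrable b volume)
    (hbmo : ∀ (x : EuclideanSpace ℝ (Fin d)) (r : ℝ), 0 < r →
      ⨍ y in ball x r, |b y - ⨍ w in ball x r, b w| ≤ M)
    (y : EuclideanSpace ℝ (Fin d)) {r q : ℝ} (hr : 0 < r) (hq : q = 2 ∨ q = 1 / 2) (k : ℕ) :
    ⨍ x in ball y (r * q ^ k), |b x| ≤ (⨍ x in ball y r, |b x|) + k * ((2 ^ d + 1) * M) := by
  have hq0 : 0 < q := by rcases hq with rfl | rfl <;> norm_num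
  induction k with
  | zero => simp
  | succ k ih =>
    push_cast
    have hrk : 0 < r * q ^ k := by positivity
    rcases hq with rfl | rfl
    · have := abs_le.1 (abs_ballMean_sub_ballMean_double_le hb hbmo y hrk)
      rw [show r * 2 ^ (k + 1) = 2 * (r * 2 ^ k) by ring]
      linarith
    · have := abs_le.1 (abs_ballMean_sub_ballMean_double_le hb hbmo y
        (r := r * (1 / 2) ^ (k + 1)) (by positivity))
      rw [show 2 * (r * (1 / 2) ^ (k + 1)) = r * (1 / 2) ^ k by ring] at this
      linarith

lemma setIntegral_ball_scale_le (hb : LocallyIntegrable b volume)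
    (hbmo : ∀ (x : EuclideanSpace ℝ (Fin d)) (r : ℝ), 0 < r →
      ⨍ y in ball x r, |b y - ⨍ w in ball x r, b w| ≤ M)
    (y : EuclideanSpace ℝ (Fin d)) {r q : ℝ} (hr : 0 < r) (hq : q = 2 ∨ q = 1 / 2) (k : ℕ) :
    ∫ x in ball y (r * q ^ k), |b x| ≤
      (r * q ^ k) ^ d * volume.real (ball (0 : EuclideanSpace ℝ (Fin d)) 1) *
        ((⨍ x in ball y r, |b x|) + k * ((2 ^ d + 1) * M)) := by
  have hq0 : 0 < q := by rcases hq with rfl | rfl <;> norm_num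
  have hω := volume_real_unitBall_pos d
  have h := ballMean_scale_le hb hbmo y hr hq k
  rw [setAverage_eq, volume_real_ball_euclidean _ (by positivity), smul_eq_mul,
    inv_mul_le_iff₀ (by positivity)] at h
  exact h

lemma summable_affine_mul_geometric {q : ℝ} (hq0 : 0 ≤ q) (hq1 : q < 1) (m L : ℝ) :
    Summable fun k : ℕ => q ^ k * (m + k * L) := by
  have h0 := (summable_geometric_of_lt_one hq0 hq1).mul_right m
  have h1 := (summable_pow_mul_geometric_of_norm_lt_one 1
    (by rwa [Real.norm_of_nonneg hq0] : ‖q‖ < 1)).mul_right L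
  refine (h0.add h1).congr fun k => ?_
  ring

lemma tsum_affine_mul_geometric {q : ℝ} (hq0 : 0 ≤ q) (hq1 : q < 1) (m L : ℝ) :
    ∑' k : ℕ, q ^ k * (m + k * L) = (∑' k : ℕ, q ^ k) * m + (∑' k : ℕ, k * q ^ k) * L := by
  have h0 := summable_geometric_of_lt_one hq0 hq1
  have h1 : Summable fun k : ℕ => (k : ℝ) * q ^ k := by
    simpa using summable_pow_mul_geometric_of_norm_lt_one 1
      (by rwa [Real.norm_of_nonneg hq0] : ‖q‖ < 1)
  rw [← tsum_mul_right, ← tsum_mul_right, ← (h0.mul_right m).tsum_add (h1.mul_right L)]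
  exact tsum_congr fun k => by ring

/-- The weighted integrability of functions of bounded mean oscillation. -/
lemma integrable_mul_one_add_norm_rpow {α : ℝ} (hα1 : α < 1) (hb : LocallyIntegrable b volume)
    (hbmo : ∀ (x : EuclideanSpace ℝ (Fin d)) (r : ℝ), 0 < r →
      ⨍ y in ball x r, |b y - ⨍ w in ball x r, b w| ≤ M) :
    Integrable fun x => b x * (1 + ‖x‖) ^ (α - 1 - d) := by
  set ω := volume.real (ball (0 : EuclideanSpace ℝ (Fin d)) 1)
  set m := ⨍ x in ball (0 : EuclideanSpace ℝ (Fin d)) 2, |b x|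
  set L := (2 ^ d + 1) * M
  refine (integrable_mul_of_cover (S := fun k => ball 0 (2 * 2 ^ k))
    (c := fun k => (2 ^ k : ℝ) ^ (α - 1 - d)) (a := fun k => (2 * 2 ^ k) ^ d * ω * (m + k * L))
    hb.aestronglyMeasurable (by fun_prop) (fun k => measurableSet_ball)
    (fun k => hb.integrableOn_ball _ _)
    (fun k => setIntegral_ball_scale_le hb hbmo 0 two_pos (Or.inl rfl) k)
    (fun k => by positivity) ?_ fun x => Or.inr ?_).1
  · have hq1 : (2 : ℝ) ^ (α - 1) < 1 := Real.rpow_lt_one_of_one_lt_of_neg one_lt_two (by linarith)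
    refine ((summable_affine_mul_geometric (by positivity) hq1 m L).mul_left (2 ^ d * ω)).congr
      fun k => ?_
    have hX : (0 : ℝ) < 2 ^ k := by positivity
    rw [Real.rpow_sub hX, Real.rpow_natCast, Real.rpow_pow_comm zero_le_two, mul_pow]
    field_simp
  · obtain ⟨k, hk1, hk2⟩ := exists_nat_pow_near (x := 1 + ‖x‖) (y := (2 : ℝ))
      (by linarith [norm_nonneg x]) one_lt_two
    refine ⟨k, ?_, ?_⟩
    · rw [mem_ball_zero_iff]
      rw [pow_succ] at hk2
      linarith
    · rw [abs_of_nonneg (by positivity)]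
      exact Real.rpow_le_rpow_of_nonpos (by positivity) hk1 (by linarith [d.cast_nonneg (α := ℝ)])

/-- The singular part of the kernel `t ↦ t ^ p`. -/
noncomputable def truncatedRpow (p t : ℝ) : ℝ := if t < 1 then t ^ p else 0

lemma measurable_truncatedRpow (p : ℝ) : Measurable (truncatedRpow p) :=
  Measurable.ite measurableSet_Iio (by fun_prop) measurable_const

lemma truncatedRpow_nonneg (p : ℝ) {t : ℝ} (ht : 0 ≤ t) : 0 ≤ truncatedRpow p t := by
  unfold truncatedRpow
  split_ifs <;> positivity

lemma rpow_le_truncatedRpow_add_one {p t : ℝ} (hp : p ≤ 0) : t ^ p ≤ truncatedRpow p t + 1 := by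
  unfold truncatedRpow
  split_ifs with h
  · linarith
  · rw [zero_add]
    exact Real.rpow_le_one_of_one_le_of_nonpos (not_lt.1 h) hp

lemma exists_integral_mul_truncatedRpow_le {α : ℝ} (hα0 : 0 < α) (hαd : α < d)
    (hb : LocallyIntegrable b volume)
    (hbmo : ∀ (x : EuclideanSpace ℝ (Fin d)) (r : ℝ), 0 < r →
      ⨍ y in ball x r, |b y - ⨍ w in ball x r, b w| ≤ M) :
    ∃ A B : ℝ, 0 ≤ A ∧ ∀ y : EuclideanSpace ℝ (Fin d),
      Integrable (fun x => b x * truncatedRpow (α - d) ‖x - y‖) ∧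
      ∫ x, |b x * truncatedRpow (α - d) ‖x - y‖| ≤ A * (⨍ x in ball y 2, |b x|) + B := by
  set ω := volume.real (ball (0 : EuclideanSpace ℝ (Fin d)) 1)
  have hω : 0 < ω := volume_real_unitBall_pos d
  set L := (2 ^ d + 1) * M
  set q : ℝ := (1 / 2) ^ α
  have hq0 : 0 ≤ q := by positivity
  have hq1 : q < 1 := Real.rpow_lt_one (by norm_num) (by norm_num) hα0
  set D : ℝ := (1 / 2) ^ (α - d) * 2 ^ d * ω
  refine ⟨D * ∑' k : ℕ, q ^ k, D * ((∑' k : ℕ, k * q ^ k) * L), by positivity, fun y => ?_⟩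
  set m := ⨍ x in ball y 2, |b x|
  have hterm : ∀ k : ℕ, (((1 / 2) ^ (k + 1) : ℝ) ^ (α - d)) *
      ((2 * (1 / 2) ^ k) ^ d * ω * (m + k * L)) = D * (q ^ k * (m + k * L)) := fun k => by
    have hX : (0 : ℝ) < (1 / 2) ^ k := by positivity
    rw [pow_succ, Real.mul_rpow hX.le (by norm_num), Real.rpow_sub hX, Real.rpow_natCast,
      mul_pow 2, show ((1 / 2 : ℝ) ^ k) ^ α = q ^ k from
        (Real.rpow_pow_comm (x := 1 / 2) (by norm_num) α k).symm]
    simp only [D]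
    field_simp
  have key := integrable_mul_of_cover (μ := volume) (b := b)
    (g := fun x => truncatedRpow (α - d) ‖x - y‖) (S := fun k => ball y (2 * (1 / 2) ^ k))
    (c := fun k => ((1 / 2) ^ (k + 1) : ℝ) ^ (α - d))
    (a := fun k => (2 * (1 / 2) ^ k) ^ d * ω * (m + k * L))
    hb.aestronglyMeasurable ((measurable_truncatedRpow _).comp (by fun_prop))
    (fun k => measurableSet_ball)
    (fun k => hb.integrableOn_ball _ _)
    (fun k => setIntegral_ball_scale_le hb hbmo y two_pos (Or.inr rfl) k)
    (fun k => by positivity)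
    (by simp only [hterm]; exact (summable_affine_mul_geometric hq0 hq1 m L).mul_left D) ?_
  · refine ⟨key.1, key.2.trans_eq ?_⟩
    simp only [hterm]
    rw [tsum_mul_left, tsum_affine_mul_geometric hq0 hq1]
    ring
  · intro x
    rw [abs_of_nonneg (truncatedRpow_nonneg _ (norm_nonneg _))]
    unfold truncatedRpow
    split_ifs with h
    swap
    · exact Or.inl rfl
    rcases (norm_nonneg (x - y)).eq_or_lt with h0 | h0
    · left
      rw [← h0, Real.zero_rpow (by linarith)]
    · right
      obtain ⟨k, hk1, hk2⟩ := exists_nat_pow_near_of_lt_one h0 h.le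
        (by norm_num : (0 : ℝ) < 1 / 2) (by norm_num)
      refine ⟨k, ?_, Real.rpow_le_rpow_of_nonpos (by positivity) hk1.le (by linarith)⟩
      rw [mem_ball_iff_norm]
      have : (0 : ℝ) < (1 / 2) ^ k := by positivity
      linarith

lemma ballMean_two_le {α : ℝ} (hα0 : 0 < α) (hα1 : α < 1) (hb : LocallyIntegrable b volume)
    (hbmo : ∀ (x : EuclideanSpace ℝ (Fin d)) (r : ℝ), 0 < r →
      ⨍ y in ball x r, |b y - ⨍ w in ball x r, b w| ≤ M) :
    ∃ C : ℝ, ∀ y : EuclideanSpace ℝ (Fin d),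
      ⨍ x in ball y 2, |b x| ≤ C * (3 + ‖y‖) ^ (d + 1) := by
  have hJ := integrable_mul_one_add_norm_rpow hα1 hb hbmo
  refine ⟨(volume.real (ball (0 : EuclideanSpace ℝ (Fin d)) 2))⁻¹ *
    ∫ x, |b x * (1 + ‖x‖) ^ (α - 1 - d)|, fun y => ?_⟩
  rw [setAverage_eq, smul_eq_mul, volume_real_ball_euclidean y two_pos,
    volume_real_ball_euclidean 0 two_pos, mul_assoc]
  gcongr
  have hle : ∀ x ∈ ball y 2, |b x| ≤ |b x * (1 + ‖x‖) ^ (α - 1 - d)| * (3 + ‖y‖) ^ (d + 1) := by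
    intro x hx
    have hxy : 1 + ‖x‖ ≤ 3 + ‖y‖ := by
      rw [mem_ball_iff_norm] at hx
      linarith [norm_sub_norm_le x y]
    have h1 : (0 : ℝ) < 1 + ‖x‖ := by positivity
    rw [abs_mul, mul_assoc]
    refine le_mul_of_one_le_right (abs_nonneg _) ?_
    rw [abs_of_pos (by positivity)]
    calc (1 : ℝ) = (1 + ‖x‖) ^ (-(d + 1 : ℕ) : ℝ) * (1 + ‖x‖) ^ (d + 1) := by
          rw [Real.rpow_neg h1.le, Real.rpow_natCast, inv_mul_cancel₀ (by positivity)]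
      _ ≤ _ := by
          gcongr
          · linarith [norm_nonneg x]
          · push_cast; linarith
  calc ∫ x in ball y 2, |b x|
      ≤ ∫ x in ball y 2, |b x * (1 + ‖x‖) ^ (α - 1 - d)| * (3 + ‖y‖) ^ (d + 1) :=
        setIntegral_mono_on (hb.integrableOn_ball y 2).abs (hJ.abs.mul_const _).integrableOn
          measurableSet_ball hle
    _ ≤ ∫ x, |b x * (1 + ‖x‖) ^ (α - 1 - d)| * (3 + ‖y‖) ^ (d + 1) :=
        setIntegral_le_integral (hJ.abs.mul_const _) (ae_of_all _ fun x => by positivity)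
    _ = _ := integral_mul_const _ _

lemma abs_rpow_sub_rpow_le {p a t u : ℝ} (hp : p ≤ 0) (ha : 0 < a) (ht : a ≤ t) (hu : a ≤ u) :
    |u ^ p - t ^ p| ≤ -p * a ^ (p - 1) * |u - t| := by
  rw [← Real.norm_eq_abs, ← Real.norm_eq_abs]
  refine Convex.norm_image_sub_le_of_norm_hasDerivWithin_le (f := fun x : ℝ => x ^ p)
    (s := Set.Ici a) (f' := fun x => p * x ^ (p - 1)) (fun x hx => ?_) (fun x hx => ?_) (convex_Ici a) ht hu
  · exact (Real.hasDerivAt_rpow_const (Or.inl (ha.trans_le hx).ne')).hasDerivWithinAt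
  · have hx0 : 0 < x := ha.trans_le hx
    rw [norm_mul, Real.norm_of_nonpos hp, Real.norm_of_nonneg (by positivity)]
    exact mul_le_mul_of_nonneg_left (Real.rpow_le_rpow_of_nonpos ha hx (by linarith))
      (neg_nonneg.2 hp)

/-- The difference of two negative powers is controlled by the singular parts and a term
decaying with one extra power. -/
lemma abs_rpow_sub_rpow_le_truncatedRpow {p t u r : ℝ} {d : ℕ} (hp : p ≤ 0) (hpd : -p ≤ d)
    (ht : 0 ≤ t) (hu : 0 ≤ u) (hr : 0 ≤ r) (htu : |u - t| ≤ r) :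
    |u ^ p - t ^ p| ≤ truncatedRpow p t + truncatedRpow p u +
      4 ^ (d + 1) * (d + 2) * (3 + r) ^ (d + 1) * (1 + t) ^ (p - 1) := by
  have hTt := truncatedRpow_nonneg p ht
  have hTu := truncatedRpow_nonneg p hu
  have h1t : 0 < 1 + t := by positivity
  have hpow : ∀ z : ℝ, 1 ≤ z → z ^ (1 - p) ≤ z ^ (d + 1) := fun z hz => by
    rw [← Real.rpow_natCast]
    exact Real.rpow_le_rpow_of_exponent_le hz (by push_cast; linarith)
  rcases le_or_gt (1 + 2 * r) t with h | h
  · have hu' : (1 + t) / 4 ≤ u := by linarith [abs_le.1 htu]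
    have h2 := abs_rpow_sub_rpow_le hp (by positivity) (by linarith : (1 + t) / 4 ≤ t) hu'
    have h3 : ((1 + t) / 4) ^ (p - 1) ≤ 4 ^ (d + 1) * (1 + t) ^ (p - 1) := by
      rw [Real.div_rpow h1t.le (by norm_num), div_eq_inv_mul, ← Real.rpow_neg (by norm_num),
        neg_sub]
      gcongr
      exact hpow 4 (by norm_num)
    have h4 : |u - t| ≤ (3 + r) ^ (d + 1) := by
      refine (htu.trans (by linarith)).trans (le_self_pow₀ (by linarith) (by omega))
    calc |u ^ p - t ^ p| ≤ -p * ((1 + t) / 4) ^ (p - 1) * |u - t| := h2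
      _ ≤ (d + 2) * (4 ^ (d + 1) * (1 + t) ^ (p - 1)) * (3 + r) ^ (d + 1) := by
          gcongr
          linarith
      _ = 4 ^ (d + 1) * (d + 2) * (3 + r) ^ (d + 1) * (1 + t) ^ (p - 1) := by ring
      _ ≤ _ := by linarith
  · have h1 : |u ^ p - t ^ p| ≤ truncatedRpow p t + truncatedRpow p u + 1 := by
      have a1 := rpow_le_truncatedRpow_add_one (t := t) hp
      have a2 := rpow_le_truncatedRpow_add_one (t := u) hp
      have a3 : 0 ≤ t ^ p := by positivity
      have a4 : 0 ≤ u ^ p := by positivity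
      rw [abs_le]
      constructor <;> linarith
    have h2 : 1 ≤ 4 ^ (d + 1) * (d + 2) * (3 + r) ^ (d + 1) * (1 + t) ^ (p - 1) := by
      calc (1 : ℝ) = (1 + t) ^ (1 - p) * (1 + t) ^ (p - 1) := by
            rw [← Real.rpow_add h1t]; simp
        _ ≤ (1 + t) ^ (d + 1) * (1 + t) ^ (p - 1) := by
            gcongr
            exact hpow _ (by linarith)
        _ ≤ (4 * (3 + r)) ^ (d + 1) * (1 + t) ^ (p - 1) := by
            gcongr
            linarith
        _ ≤ _ := by
            rw [mul_pow]
            gcongr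
            exact le_mul_of_one_le_right (by positivity)
              (by linarith [d.cast_nonneg (α := ℝ)])
    linarith

lemma measurable_rieszKernelDiff (d : ℕ) (α : ℝ) :
    Measurable fun z : EuclideanSpace ℝ (Fin d) × EuclideanSpace ℝ (Fin d) =>
      rieszKernelDiff d α z.1 z.2 := by
  unfold rieszKernelDiff
  fun_prop

/-- Absolute convergence of the renormalized potential, with polynomial growth in `y`. -/
lemma exists_integral_abs_mul_rieszKernelDiff_le {α : ℝ} (hd : 0 < d) (hα0 : 0 < α) (hα1 : α < 1)
    (hb : LocallyIntegrable b volume)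
    (hbmo : ∀ (x : EuclideanSpace ℝ (Fin d)) (r : ℝ), 0 < r →
      ⨍ y in ball x r, |b y - ⨍ w in ball x r, b w| ≤ M) :
    ∃ C : ℝ, ∀ y : EuclideanSpace ℝ (Fin d),
      Integrable (fun x => b x * rieszKernelDiff d α x y) ∧
      ∫ x, |b x * rieszKernelDiff d α x y| ≤ C * (3 + ‖y‖) ^ (d + 1) := by
  have hd1 : (1 : ℝ) ≤ d := by exact_mod_cast hd
  have hJ := integrable_mul_one_add_norm_rpow hα1 hb hbmo
  set J := ∫ x, |b x * (1 + ‖x‖) ^ (α - 1 - d)|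
  obtain ⟨A, B, hA, hAB⟩ := exists_integral_mul_truncatedRpow_le hα0 (by linarith) hb hbmo
  obtain ⟨C, hC⟩ := ballMean_two_le hα0 hα1 hb hbmo
  set K : ℝ := 4 ^ (d + 1) * (d + 2)
  set N := A * (⨍ x in ball (0 : EuclideanSpace ℝ (Fin d)) 2, |b x|) + B
  refine ⟨|N| + (A * C + |B|) + K * J, fun y => ?_⟩
  set P := (3 + ‖y‖) ^ (d + 1)
  have hP : 1 ≤ P := one_le_pow₀ (by linarith [norm_nonneg y])
  have h0 := hAB 0
  simp only [sub_zero] at h0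
  have hy := hAB y
  have hpt : ∀ x, |b x * rieszKernelDiff d α x y| ≤
      |b x * truncatedRpow (α - d) ‖x‖| + |b x * truncatedRpow (α - d) ‖x - y‖| +
        K * P * |b x * (1 + ‖x‖) ^ (α - 1 - d)| := fun x => by
    have h := abs_rpow_sub_rpow_le_truncatedRpow (p := α - d) (d := d) (t := ‖x‖) (u := ‖x - y‖)
      (r := ‖y‖) (by linarith) (by linarith) (norm_nonneg _) (norm_nonneg _) (norm_nonneg _)
      (by simpa using abs_norm_sub_norm_le (x - y) x)
    rw [show α - d - 1 = α - 1 - (d : ℝ) by ring] at h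
    have h' := mul_le_mul_of_nonneg_left h (abs_nonneg (b x))
    simp only [abs_mul, abs_of_nonneg (truncatedRpow_nonneg (α - d) (norm_nonneg _)),
      abs_of_nonneg (by positivity : 0 ≤ (1 + ‖x‖) ^ (α - 1 - (d : ℝ)))]
    refine h'.trans_eq ?_
    ring
  have hint := (h0.1.abs.add hy.1.abs).add (hJ.abs.const_mul (K * P))
  have hI : Integrable (fun x => b x * rieszKernelDiff d α x y) :=
    hint.mono' (hb.aestronglyMeasurable.mul
      ((measurable_rieszKernelDiff d α).comp (by fun_prop : Measurable fun x =>
        (x, y))).aestronglyMeasurable) (ae_of_all _ hpt)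
  refine ⟨hI, ?_⟩
  calc ∫ x, |b x * rieszKernelDiff d α x y|
      ≤ ∫ x, (|b x * truncatedRpow (α - d) ‖x‖| + |b x * truncatedRpow (α - d) ‖x - y‖| +
        K * P * |b x * (1 + ‖x‖) ^ (α - 1 - d)|) := integral_mono hI.abs hint hpt
    _ = (∫ x, |b x * truncatedRpow (α - d) ‖x‖|) +
        (∫ x, |b x * truncatedRpow (α - d) ‖x - y‖|) + K * P * J := by
        rw [integral_add (by exact h0.1.abs.add hy.1.abs) (hJ.abs.const_mul (K * P)),
          integral_add h0.1.abs hy.1.abs, integral_const_mul]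
    _ ≤ |N| * P + (A * (C * P) + |B| * P) + K * P * J := by
        have e1 : N ≤ |N| * P :=
          (le_abs_self N).trans (le_mul_of_one_le_right (abs_nonneg _) hP)
        have e2 : B ≤ |B| * P :=
          (le_abs_self B).trans (le_mul_of_one_le_right (abs_nonneg _) hP)
        have e3 := mul_le_mul_of_nonneg_left (hC y) hA
        linarith [h0.2, hy.2]
    _ = _ := by ring

end BMO

lemma SchwartzMap.integrable_const_add_norm_pow_mul {d : ℕ}
    (φ : SchwartzMap (EuclideanSpace ℝ (Fin d)) ℝ) (c : ℝ) (n : ℕ) :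
    Integrable fun y => (c + ‖y‖) ^ n * |φ y| := by
  simp only [add_pow, Finset.sum_mul]
  refine integrable_finsetSum _ fun k _ => ?_
  refine ((φ.integrable_pow_mul volume (n - k)).const_mul (c ^ k * n.choose k)).congr
    (ae_of_all _ fun y => ?_)
  simp only [Real.norm_eq_abs]
  ring

/-- For `0 < α < 1` and `b` locally integrable with BMO seminorm at most `M`:
(i) `F(y) := ∫ b(x)(|x−y|^{α−d} − |x|^{α−d}) dx` converges absolutely for every `y`; and
(ii) for every mean-zero Schwartz `φ`, the function `x ↦ b(x) ∫ φ(y)(|x−y|^{α−d} − |x|^{α−d}) dy`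
is absolutely integrable and `∫ b(x)(∫ φ(y) K(x,y) dy) dx = ∫ F(y) φ(y) dy`.  Hence the
distribution `I_α(b)` coincides with the function `F`. -/
theorem riesz_potential_of_bmo_is_function (d : ℕ) (hd : 0 < d)
    (α : ℝ) (hα0 : 0 < α) (hα1 : α < 1)
    (M : ℝ) (hM : 0 ≤ M) (b : EuclideanSpace ℝ (Fin d) → ℝ)
    (hb : LocallyIntegrable b volume)
    (hbmo : ∀ (x : EuclideanSpace ℝ (Fin d)) (r : ℝ), 0 < r →
      ⨍ y in ball x r, |b y - ⨍ w in ball x r, b w| ≤ M) :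
    (∀ y : EuclideanSpace ℝ (Fin d),
      Integrable (fun x => b x * rieszKernelDiff d α x y)) ∧
    (∀ φ : SchwartzMap (EuclideanSpace ℝ (Fin d)) ℝ, (∫ x, φ x) = 0 →
      Integrable (fun x => b x * ∫ y, φ y * rieszKernelDiff d α x y) ∧
      (∫ x, b x * ∫ y, φ y * rieszKernelDiff d α x y) =
        ∫ y, (∫ x, b x * rieszKernelDiff d α x y) * φ y) := by
  obtain ⟨C, hC⟩ := exists_integral_abs_mul_rieszKernelDiff_le hd hα0 hα1 hb hbmo
  refine ⟨fun y => (hC y).1, fun φ _ => ?_⟩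
  set f : EuclideanSpace ℝ (Fin d) → EuclideanSpace ℝ (Fin d) → ℝ :=
    fun x y => b x * (φ y * rieszKernelDiff d α x y)
  have hfeq : ∀ x y, f x y = b x * rieszKernelDiff d α x y * φ y := fun x y => by
    simp only [f]
    ring
  have hm : AEStronglyMeasurable (Function.uncurry f) (volume.prod volume) :=
    hb.aestronglyMeasurable.comp_fst.mul
      ((φ.continuous.measurable.comp measurable_snd).mul
        (measurable_rieszKernelDiff d α)).aestronglyMeasurable
  have hint : Integrable (Function.uncurry f) (volume.prod volume) := by
    refine (integrable_prod_iff' hm).2 ⟨ae_of_all _ fun y => ?_, ?_⟩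
    · simp only [Function.uncurry, hfeq]
      exact (hC y).1.mul_const _
    · refine ((φ.integrable_const_add_norm_pow_mul 3 (d + 1)).const_mul C).mono'
        hm.norm.prod_swap.integral_prod_right' (ae_of_all _ fun y => ?_)
      rw [Real.norm_of_nonneg (integral_nonneg fun x => norm_nonneg _)]
      simp only [Function.uncurry, hfeq, norm_mul, integral_mul_const]
      rw [← mul_assoc]
      refine mul_le_mul_of_nonneg_right ?_ (abs_nonneg _)
      simpa only [abs_mul, Real.norm_eq_abs] using (hC y).2
  have hx : ∀ x, ∫ y, f x y = b x * ∫ y, φ y * rieszKernelDiff d α x y := fun x =>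
    integral_const_mul _ _
  refine ⟨?_, ?_⟩
  · simpa only [Function.uncurry, hx] using hint.integral_prod_left
  · simp only [← hx]
    rw [integral_integral_swap hint]
    simp only [hfeq, integral_mul_const]
end
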